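/- arXiv:1012.4961 — 9 statements merged into one kernel-verified Lean document; each statement's English description precedes it below -/
import Mathlib

section
/- In the subgraph setup with the map Φ_c: Φ_c restricted to closure(O₂) is a bijection of closure(O₂) onto closure(O_{1,c}); Φ_c maps the topological boundary of O₂ bijectively onto the topological boundary of O_{1,c}; Φ_c is continuous on closure(O₂); and Φ_c(x) = x for every x ∈ closure(O₃). -/
open Set

lemma subgraph_isOpen {X : Type*} [TopologicalSpace X] {W : Set X} (hW : IsOpen W) (a : ℝ)
    {g : X → ℝ} (hg : Continuous g) :
    IsOpen {p : X × ℝ | p.1 ∈ W ∧ a < p.2 ∧ p.2 < g p.1} :=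
  (hW.preimage continuous_fst).inter
    ((isOpen_lt continuous_const continuous_snd).inter
      (isOpen_lt continuous_snd (hg.comp continuous_fst)))

lemma subgraph_closure {X : Type*} [TopologicalSpace X] (W : Set X) (a : ℝ)
    {g : X → ℝ} (hg : Continuous g) (hag : ∀ x ∈ closure W, a < g x) :
    closure {p : X × ℝ | p.1 ∈ W ∧ a < p.2 ∧ p.2 < g p.1} =
      {p : X × ℝ | p.1 ∈ closure W ∧ a ≤ p.2 ∧ p.2 ≤ g p.1} := by
  apply Subset.antisymm
  · refine closure_minimal (fun p hp => ⟨subset_closure hp.1, hp.2.1.le, hp.2.2.le⟩) ?_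
    exact (isClosed_closure.preimage continuous_fst).inter
      ((isClosed_le continuous_const continuous_snd).inter
        (isClosed_le continuous_snd (hg.comp continuous_fst)))
  · rintro ⟨x, t⟩ ⟨hx, hat, htg⟩
    have hV : IsOpen {p : X × ℝ | a < p.2 ∧ p.2 < g p.1} :=
      (isOpen_lt continuous_const continuous_snd).inter
        (isOpen_lt continuous_snd (hg.comp continuous_fst))
    have hinner : ∀ s ∈ Ioo a (g x),
        (x, s) ∈ closure {p : X × ℝ | p.1 ∈ W ∧ a < p.2 ∧ p.2 < g p.1} := by
      intro s hs
      have hxs : (x, s) ∈ closure (W ×ˢ (univ : Set ℝ)) := by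
        rw [closure_prod_eq, closure_univ]
        exact ⟨hx, mem_univ s⟩
      refine closure_mono ?_ (hV.inter_closure ⟨hs, hxs⟩)
      rintro q ⟨hq, hqW⟩
      exact ⟨hqW.1, hq⟩
    have ht : t ∈ closure (Ioo a (g x)) := by
      rw [closure_Ioo (hag x hx).ne]
      exact ⟨hat, htg⟩
    have := map_mem_closure (f := fun s : ℝ => (x, s)) (by fun_prop) ht hinner
    rwa [closure_closure] at this

/-- The vertical displacement above the level `b`, over a layer of thickness `e`. -/
noncomputable def bump (m : ℕ) (b e t : ℝ) : ℝ := e * (max (t - b) 0 / e) ^ (m + 1)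

lemma bump_of_le (m : ℕ) {b e t : ℝ} (ht : t ≤ b) : bump m b e t = 0 := by
  simp [bump, max_eq_right (sub_nonpos.2 ht)]

lemma bump_top (m : ℕ) {b e : ℝ} (he : 0 ≤ e) : bump m b e (b + e) = e := by
  rcases he.eq_or_lt with rfl | he'
  · simp [bump]
  · simp [bump, max_eq_left he, div_self he'.ne']

lemma bump_mono (m : ℕ) (b : ℝ) {e : ℝ} (he : 0 ≤ e) : Monotone (bump m b e) := by
  intro s t hst
  unfold bump
  gcongr

lemma bump_nonneg (m : ℕ) (b t : ℝ) {e : ℝ} (he : 0 ≤ e) : 0 ≤ bump m b e t := by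
  unfold bump
  positivity

lemma continuous_bump (m : ℕ) (b e : ℝ) : Continuous (bump m b e) := by
  unfold bump
  fun_prop

lemma continuousOn_bump {Y : Type*} [TopologicalSpace Y] (m : ℕ) {s : Set Y} {b e t : Y → ℝ}
    (hb : Continuous b) (he : Continuous e) (ht : Continuous t) (he0 : ∀ y, 0 ≤ e y)
    (hts : ∀ y ∈ s, t y ≤ b y + e y) :
    ContinuousOn (fun y => bump m (b y) (e y) (t y)) s := by
  intro y hy
  rcases (he0 y).eq_or_lt with h0 | hpos
  · have hval : bump m (b y) (e y) (t y) = 0 := by simp [bump, ← h0]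
    simp only [ContinuousWithinAt, hval]
    refine tendsto_of_tendsto_of_tendsto_of_le_of_le' (g := fun _ => (0 : ℝ)) (h := e)
      tendsto_const_nhds ?_ (Filter.Eventually.of_forall fun z => bump_nonneg m _ _ (he0 z)) ?_
    · rw [h0]
      exact he.continuousWithinAt
    · filter_upwards [self_mem_nhdsWithin] with z hz
      exact (bump_mono m (b z) (he0 z) (hts z hz)).trans_eq (bump_top m (he0 z))
  · unfold bump
    exact (he.continuousAt.mul (((((ht.sub hb).max continuous_const).continuousAt).div
      he.continuousAt hpos.ne').pow (m + 1))).continuousWithinAt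

lemma strictMono_add_bump (m : ℕ) (b : ℝ) {c e : ℝ} (hc : 0 ≤ c) (he : 0 ≤ e) :
    StrictMono (fun t => t + c * bump m b e t) :=
  strictMono_id.add_monotone ((bump_mono m b he).const_mul hc)

/-- In the subgraph setup with the map `Φ_c`: `Φ_c` is a bijection of `closure(O₂)`
onto `closure(O_{1,c})`, maps `∂O₂` bijectively onto `∂O_{1,c}`, is continuous on
`closure(O₂)`, and is the identity on `closure(O₃)`. -/
theorem stmt4 (N m : ℕ) (hN : 2 ≤ N) (hm : 1 ≤ m)
    (W : Set (EuclideanSpace ℝ (Fin (N - 1)))) (hWne : W.Nonempty)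
    (hWbd : Bornology.IsBounded W) (hWcon : Convex ℝ W) (hWop : IsOpen W)
    (a D₁ D₂ : ℝ) (haD₂ : a < D₂) (hD₂D₁ : D₂ < D₁)
    (g₁ g₂ : EuclideanSpace ℝ (Fin (N - 1)) → ℝ)
    (hg₁c : Continuous g₁) (hg₂c : Continuous g₂)
    (hg₂ : ∀ x ∈ closure W, D₂ < g₂ x) (hg₁ : ∀ x ∈ closure W, g₁ x < D₁)
    (δ : ℝ) (hδ : δ = (D₂ - a) / (2 * (D₁ - D₂)))
    (c : ℝ) (hc : 1 / δ ≤ c)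
    (g₃ g1c : EuclideanSpace ℝ (Fin (N - 1)) → ℝ)
    (hg₃ : ∀ x, g₃ x = g₂ x - δ * max (g₁ x - g₂ x) 0)
    (hg1c : ∀ x, g1c x = g₂ x + c * δ * max (g₁ x - g₂ x) 0)
    (O : (EuclideanSpace ℝ (Fin (N - 1)) → ℝ) →
      Set (EuclideanSpace ℝ (Fin (N - 1)) × ℝ))
    (hO : ∀ g, O g = {p | p.1 ∈ W ∧ a < p.2 ∧ p.2 < g p.1})
    (h : EuclideanSpace ℝ (Fin (N - 1)) × ℝ → ℝ)
    (hh0 : ∀ p ∈ closure (O g₃), h p = 0)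
    (hh1 : ∀ p ∈ closure (O g₂) \ closure (O g₃),
      h p = (p.2 - g₃ p.1) ^ (m + 1) / (δ ^ m * (g₁ p.1 - g₂ p.1) ^ m))
    (Φc : EuclideanSpace ℝ (Fin (N - 1)) × ℝ → EuclideanSpace ℝ (Fin (N - 1)) × ℝ)
    (hΦc : ∀ p, Φc p = (p.1, p.2 + c * h p)) :
    Set.BijOn Φc (closure (O g₂)) (closure (O g1c)) ∧
    Set.BijOn Φc (frontier (O g₂)) (frontier (O g1c)) ∧
    ContinuousOn Φc (closure (O g₂)) ∧
    ∀ x ∈ closure (O g₃), Φc x = x := by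
  have hδ0 : 0 < δ := hδ ▸ div_pos (by linarith) (by linarith)
  have hc0 : 0 ≤ c := (by positivity : 0 ≤ 1 / δ).trans hc
  set e : EuclideanSpace ℝ (Fin (N - 1)) → ℝ := fun x => δ * max (g₁ x - g₂ x) 0 with he
  have he0 : ∀ x, 0 ≤ e x := fun x => by simp only [he]; positivity
  have hec : Continuous e := by simp only [he]; fun_prop
  have hg₃e : ∀ x, g₃ x + e x = g₂ x := fun x => by rw [hg₃]; simp [he]
  have hg1ce : ∀ x, g1c x = g₂ x + c * e x := fun x => by rw [hg1c]; simp only [he]; ring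
  have hg₃c : Continuous g₃ := by
    rw [funext hg₃]
    fun_prop
  have hg1cc : Continuous g1c := by
    rw [funext hg1c]
    fun_prop
  have hag₂ : ∀ x ∈ closure W, a < g₂ x := fun x hx => haD₂.trans (hg₂ x hx)
  have hag1c : ∀ x ∈ closure W, a < g1c x := fun x hx => by
    rw [hg1ce]
    exact (hag₂ x hx).trans_le (le_add_of_nonneg_right (mul_nonneg hc0 (he0 x)))
  have hag₃ : ∀ x ∈ closure W, a < g₃ x := fun x hx => by
    have hmax : max (g₁ x - g₂ x) 0 ≤ D₁ - D₂ :=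
      max_le (by linarith [hg₁ x hx, hg₂ x hx]) (by linarith)
    have hhalf : δ * (D₁ - D₂) = (D₂ - a) / 2 := by
      have : D₁ - D₂ ≠ 0 := by linarith
      rw [hδ]
      field_simp
    have := mul_le_mul_of_nonneg_left hmax hδ0.le
    rw [hg₃]
    linarith [hg₂ x hx]
  have hcl₂ : closure (O g₂) = {p | p.1 ∈ closure W ∧ a ≤ p.2 ∧ p.2 ≤ g₂ p.1} := by
    rw [hO, subgraph_closure W a hg₂c hag₂]
  have hcl₃ : closure (O g₃) = {p | p.1 ∈ closure W ∧ a ≤ p.2 ∧ p.2 ≤ g₃ p.1} := by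
    rw [hO, subgraph_closure W a hg₃c hag₃]
  have hcl1c : closure (O g1c) = {p | p.1 ∈ closure W ∧ a ≤ p.2 ∧ p.2 ≤ g1c p.1} := by
    rw [hO, subgraph_closure W a hg1cc hag1c]
  have hΦ : ∀ p ∈ closure (O g₂), Φc p = (p.1, p.2 + c * bump m (g₃ p.1) (e p.1) p.2) := by
    intro p hp
    rw [hΦc]
    congr 3
    by_cases hp3 : p ∈ closure (O g₃)
    · rw [hh0 p hp3, bump_of_le]
      rw [hcl₃] at hp3
      exact hp3.2.2
    · rw [hh1 p ⟨hp, hp3⟩]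
      rw [hcl₂] at hp
      have hlt : g₃ p.1 < p.2 := by
        by_contra! hle
        exact hp3 (hcl₃ ▸ ⟨hp.1, hp.2.1, hle⟩)
      have hd : 0 < g₁ p.1 - g₂ p.1 := by
        by_contra! hle
        have := hg₃ p.1
        rw [max_eq_right hle] at this
        linarith [hp.2.2]
      simp only [bump, he, max_eq_left hd.le, max_eq_left (sub_pos.2 hlt).le, div_pow, mul_pow]
      field_simp
      ring
  have hmono : ∀ x, StrictMono (fun t => t + c * bump m (g₃ x) (e x) t) :=
    fun x => strictMono_add_bump m (g₃ x) hc0 (he0 x)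
  have hbot : ∀ x ∈ closure W, a + c * bump m (g₃ x) (e x) a = a := fun x hx => by
    rw [bump_of_le m (hag₃ x hx).le, mul_zero, add_zero]
  have htop : ∀ x, g₂ x + c * bump m (g₃ x) (e x) (g₂ x) = g1c x := fun x => by
    have := bump_top m (b := g₃ x) (he0 x)
    rw [hg₃e] at this
    rw [this, hg1ce]
  have hbij : BijOn Φc (closure (O g₂)) (closure (O g1c)) := by
    refine ⟨fun p hp => ?_, fun p hp q hq hpq => ?_, fun q hq => ?_⟩
    · rw [hΦ p hp, hcl1c]
      rw [hcl₂] at hp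
      refine ⟨hp.1, ?_, ?_⟩
      · exact (hbot p.1 hp.1).symm.trans_le ((hmono p.1).monotone hp.2.1)
      · exact ((hmono p.1).monotone hp.2.2).trans_eq (htop p.1)
    · rw [hΦ p hp, hΦ q hq] at hpq
      obtain ⟨x, s⟩ := p
      obtain ⟨y, t⟩ := q
      obtain ⟨rfl, hst⟩ := Prod.mk.inj hpq
      exact congrArg (Prod.mk x) ((hmono x).injective hst)
    · obtain ⟨x, s⟩ := q
      rw [hcl1c] at hq
      obtain ⟨hx, has, hsg⟩ := hq
      have hcont : Continuous (fun t => t + c * bump m (g₃ x) (e x) t) :=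
        continuous_id.add (continuous_const.mul (continuous_bump m _ _))
      obtain ⟨t, ht, hts⟩ := intermediate_value_Icc (hag₂ x hx).le hcont.continuousOn
        (show s ∈ Icc _ _ from ⟨(hbot x hx).trans_le has, hsg.trans_eq (htop x).symm⟩)
      have hmem : (x, t) ∈ closure (O g₂) := hcl₂ ▸ ⟨hx, ht.1, ht.2⟩
      refine ⟨(x, t), hmem, ?_⟩
      rw [hΦ _ hmem]
      exact congrArg (Prod.mk x) hts
  have hopen : ∀ p ∈ closure (O g₂), (Φc p ∈ O g1c ↔ p ∈ O g₂) := by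
    intro p hp
    rw [hΦ p hp, hO, hO]
    rw [hcl₂] at hp
    have h₁ := (hmono p.1).lt_iff_lt (a := a) (b := p.2)
    have h₂ := (hmono p.1).lt_iff_lt (a := p.2) (b := g₂ p.1)
    simp only [hbot p.1 hp.1] at h₁
    simp only [htop p.1] at h₂
    exact and_congr_right fun _ => and_congr h₁ h₂
  refine ⟨hbij, ?_, ?_, fun x hx => by rw [hΦc, hh0 x hx, mul_zero, add_zero]⟩
  · have hO₂ : IsOpen (O g₂) := hO g₂ ▸ subgraph_isOpen hWop a hg₂c
    have hO1c : IsOpen (O g1c) := hO g1c ▸ subgraph_isOpen hWop a hg1cc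
    rw [hO₂.frontier_eq, hO1c.frontier_eq]
    refine ⟨fun p hp => ⟨hbij.mapsTo hp.1, fun hq => hp.2 ((hopen p hp.1).1 hq)⟩,
      hbij.injOn.mono sdiff_subset, fun q hq => ?_⟩
    obtain ⟨p, hp, rfl⟩ := hbij.surjOn hq.1
    exact ⟨p, ⟨hp, fun hpO => hq.2 ((hopen p hp).2 hpO)⟩, rfl⟩
  · refine ContinuousOn.congr ?_ hΦ
    refine continuousOn_fst.prodMk (continuousOn_snd.add (continuousOn_const.mul ?_))
    refine continuousOn_bump m (hg₃c.comp continuous_fst) (hec.comp continuous_fst)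
      continuous_snd (fun p => he0 p.1) fun p hp => ?_
    rw [hcl₂] at hp
    exact hp.2.2.trans_eq (hg₃e p.1).symm
end

section
/- In the subgraph setup with the map Φ_c: for every x̄ ∈ closure(W), the one-variable map t ↦ t + c·h(x̄, t) is continuous and strictly increasing on the interval [a, g₂(x̄)] and maps this interval onto [a, g_{1,c}(x̄)]; in particular h(x̄, g₂(x̄)) = δ·max(g₁(x̄) − g₂(x̄), 0), so that Φ_c(x̄, g₂(x̄)) = (x̄, g_{1,c}(x̄)), and Φ_c(x̄, a) = (x̄, a). -/
open Set

/-- The closure of an open subgraph contains every point between the floor and the graph. -/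
theorem mem_closure_subgraph {X : Type*} [TopologicalSpace X] {W : Set X} {a : ℝ} {g : X → ℝ}
    (hg : Continuous g) (hag : ∀ x ∈ closure W, a < g x) {x : X} (hx : x ∈ closure W) {t : ℝ}
    (ht : t ∈ Icc a (g x)) :
    (x, t) ∈ closure {p : X × ℝ | p.1 ∈ W ∧ a < p.2 ∧ p.2 < g p.1} := by
  have hpos : 0 < g x - a := sub_pos.2 (hag x hx)
  let F : X × ℝ → X × ℝ := fun p => (p.1, a + p.2 * (g p.1 - a))
  have hF : Continuous F := by fun_prop
  have hmem : (x, (t - a) / (g x - a)) ∈ closure (W ×ˢ Ioo (0 : ℝ) 1) := by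
    rw [closure_prod_eq, closure_Ioo zero_ne_one]
    refine ⟨hx, div_nonneg (sub_nonneg.2 ht.1) hpos.le, ?_⟩
    rw [div_le_one hpos]
    linarith [ht.2]
  have hFx : F (x, (t - a) / (g x - a)) = (x, t) := by
    simp only [F, div_mul_cancel₀ _ hpos.ne', add_sub_cancel]
  rw [← hFx]
  refine map_mem_closure hF hmem ?_
  rintro ⟨y, s⟩ ⟨hy, hs0, hs1⟩
  have hy' : 0 < g y - a := sub_pos.2 (hag y (subset_closure hy))
  refine ⟨hy, ?_, ?_⟩
  · linarith [mul_pos hs0 hy']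
  · change a + s * (g y - a) < g y
    nlinarith [mul_pos (sub_pos.2 hs1) hy']

/-- Points in the closure of a subgraph of a continuous function lie below its graph. -/
theorem le_of_mem_closure_subgraph {X : Type*} [TopologicalSpace X] {W : Set X} {a : ℝ}
    {g : X → ℝ} (hg : Continuous g) {p : X × ℝ}
    (hp : p ∈ closure {p : X × ℝ | p.1 ∈ W ∧ a < p.2 ∧ p.2 < g p.1}) : p.2 ≤ g p.1 :=
  closure_minimal (t := {p : X × ℝ | p.2 ≤ g p.1}) (fun _ hq => hq.2.2.le)
    (isClosed_le continuous_snd (hg.comp continuous_fst)) hp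

/-- In the subgraph setup with the map `Φ_c`: for every `x̄ ∈ closure W`, the map
`t ↦ t + c·h(x̄, t)` is continuous and strictly increasing on `[a, g₂(x̄)]` and maps
this interval onto `[a, g_{1,c}(x̄)]`; in particular `h(x̄, g₂(x̄)) = δ·(g₁(x̄)−g₂(x̄))⁺`,
so `Φ_c(x̄, g₂(x̄)) = (x̄, g_{1,c}(x̄))`, and `Φ_c(x̄, a) = (x̄, a)`. -/
theorem stmt5 (N m : ℕ) (hN : 2 ≤ N) (hm : 1 ≤ m)
    (W : Set (EuclideanSpace ℝ (Fin (N - 1)))) (hWne : W.Nonempty)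
    (hWbd : Bornology.IsBounded W) (hWcon : Convex ℝ W) (hWop : IsOpen W)
    (a D₁ D₂ : ℝ) (haD₂ : a < D₂) (hD₂D₁ : D₂ < D₁)
    (g₁ g₂ : EuclideanSpace ℝ (Fin (N - 1)) → ℝ)
    (hg₁c : Continuous g₁) (hg₂c : Continuous g₂)
    (hg₂ : ∀ x ∈ closure W, D₂ < g₂ x) (hg₁ : ∀ x ∈ closure W, g₁ x < D₁)
    (δ : ℝ) (hδ : δ = (D₂ - a) / (2 * (D₁ - D₂)))
    (c : ℝ) (hc : 1 / δ ≤ c)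
    (g₃ g1c : EuclideanSpace ℝ (Fin (N - 1)) → ℝ)
    (hg₃ : ∀ x, g₃ x = g₂ x - δ * max (g₁ x - g₂ x) 0)
    (hg1c : ∀ x, g1c x = g₂ x + c * δ * max (g₁ x - g₂ x) 0)
    (O : (EuclideanSpace ℝ (Fin (N - 1)) → ℝ) →
      Set (EuclideanSpace ℝ (Fin (N - 1)) × ℝ))
    (hO : ∀ g, O g = {p | p.1 ∈ W ∧ a < p.2 ∧ p.2 < g p.1})
    (h : EuclideanSpace ℝ (Fin (N - 1)) × ℝ → ℝ)
    (hh0 : ∀ p ∈ closure (O g₃), h p = 0)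
    (hh1 : ∀ p ∈ closure (O g₂) \ closure (O g₃),
      h p = (p.2 - g₃ p.1) ^ (m + 1) / (δ ^ m * (g₁ p.1 - g₂ p.1) ^ m))
    (Φc : EuclideanSpace ℝ (Fin (N - 1)) × ℝ → EuclideanSpace ℝ (Fin (N - 1)) × ℝ)
    (hΦc : ∀ p, Φc p = (p.1, p.2 + c * h p)) :
    ∀ x ∈ closure W,
      ContinuousOn (fun t => t + c * h (x, t)) (Icc a (g₂ x)) ∧
      StrictMonoOn (fun t => t + c * h (x, t)) (Icc a (g₂ x)) ∧
      (fun t => t + c * h (x, t)) '' Icc a (g₂ x) = Icc a (g1c x) ∧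
      h (x, g₂ x) = δ * max (g₁ x - g₂ x) 0 ∧
      Φc (x, g₂ x) = (x, g1c x) ∧
      Φc (x, a) = (x, a) := by
  intro x hx
  have hδ0 : 0 < δ := by
    rw [hδ]
    exact div_pos (by linarith) (by linarith)
  have hc0 : 0 < c := (one_div_pos.2 hδ0).trans_le hc
  have hg₃c : Continuous g₃ := by
    rw [funext hg₃]
    fun_prop
  have hag₃ : ∀ y ∈ closure W, a < g₃ y := by
    intro y hy
    have hmax : max (g₁ y - g₂ y) 0 ≤ D₁ - D₂ :=
      max_le (by linarith [hg₁ y hy, hg₂ y hy]) (by linarith)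
    have hδD : δ * (D₁ - D₂) = (D₂ - a) / 2 := by
      rw [hδ]
      field_simp [(sub_pos.2 hD₂D₁).ne']
    have := mul_le_mul_of_nonneg_left hmax hδ0.le
    rw [hg₃]
    linarith [hg₂ y hy]
  have hag₂ : ∀ y ∈ closure W, a < g₂ y := fun y hy => haD₂.trans (hg₂ y hy)
  set M := max (g₁ x - g₂ x) 0 with hM
  have hM0 : 0 ≤ M := le_max_right _ _
  have hδM : 0 ≤ δ * M := mul_nonneg hδ0.le hM0
  have hform : ∀ t ∈ Icc a (g₂ x),
      h (x, t) = max (t - g₃ x) 0 ^ (m + 1) / (δ * M) ^ m := by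
    intro t ht
    rcases le_or_gt t (g₃ x) with hle | hlt
    · rw [hh0 _ (by rw [hO]; exact mem_closure_subgraph hg₃c hag₃ hx ⟨ht.1, hle⟩),
        max_eq_right (sub_nonpos.2 hle)]
      simp
    · have hpos : 0 < g₁ x - g₂ x := by
        by_contra hneg
        have hM' : M = 0 := max_eq_right (not_lt.1 hneg)
        have := hg₃ x
        rw [← hM, hM', mul_zero, sub_zero] at this
        linarith [ht.2]
      rw [hh1 (x, t) ⟨by rw [hO]; exact mem_closure_subgraph hg₂c hag₂ hx ht, fun hmem => ?_⟩,
        max_eq_left (sub_pos.2 hlt).le, hM, max_eq_left hpos.le, mul_pow]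
      rw [hO] at hmem
      exact absurd (le_of_mem_closure_subgraph hg₃c hmem) (not_le.2 hlt)
  have hcont : ContinuousOn (fun t => t + c * h (x, t)) (Icc a (g₂ x)) := by
    have : Continuous fun t : ℝ => t + c * (max (t - g₃ x) 0 ^ (m + 1) / (δ * M) ^ m) := by
      fun_prop
    exact this.continuousOn.congr fun t ht => by simp only [hform t ht]
  have hmono : StrictMonoOn (fun t => t + c * h (x, t)) (Icc a (g₂ x)) := by
    intro s hs t ht hst
    simp only [hform s hs, hform t ht]
    refine add_lt_add_of_lt_of_le hst (mul_le_mul_of_nonneg_left ?_ hc0.le)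
    gcongr
  have ha : a ∈ Icc a (g₂ x) := left_mem_Icc.2 (hag₂ x hx).le
  have hb : g₂ x ∈ Icc a (g₂ x) := right_mem_Icc.2 (hag₂ x hx).le
  have hha : h (x, a) = 0 := by
    rw [hform a ha, max_eq_right (sub_nonpos.2 (hag₃ x hx).le)]
    simp
  have hhb : h (x, g₂ x) = δ * M := by
    rw [hform _ hb, hg₃ x, sub_sub_cancel, max_eq_left hδM]
    rcases hδM.eq_or_lt with h0 | h0
    · simp [← h0]
    · rw [pow_succ', mul_div_cancel_right₀ _ (pow_pos h0 m).ne']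
  have hfa : a + c * h (x, a) = a := by rw [hha, mul_zero, add_zero]
  have hfb : g₂ x + c * h (x, g₂ x) = g1c x := by rw [hhb, hg1c, mul_assoc]
  refine ⟨hcont, hmono, ?_, hhb, by rw [hΦc, hfb], by rw [hΦc, hfa]⟩
  refine Subset.antisymm ?_ ?_
  · rintro _ ⟨t, ht, rfl⟩
    have h₁ := hmono.monotoneOn ha ht ht.1
    have h₂ := hmono.monotoneOn ht hb ht.2
    simp only [hfa, hfb] at h₁ h₂
    exact ⟨h₁, h₂⟩
  · have := intermediate_value_Icc (hag₂ x hx).le hcont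
    simpa only [hfa, hfb] using this
end

section
/- In the subgraph setup with the map Φ_c: if in addition g₁ and g₂ are Lipschitz continuous on closure(W), then there exists L ≥ 0 such that Φ_c is Lipschitz continuous with constant L on O₂. -/
open Set

/-- On `{0 ≤ u ≤ t}` the function `u * (u / t) ^ m` is Lipschitz in `(u, t)`. -/
theorem abs_mul_div_pow_sub_le (m : ℕ) {u t u' t' : ℝ} (hu : 0 ≤ u) (hut : u ≤ t)
    (hu' : 0 ≤ u') (hut' : u' ≤ t') :
    |u * (u / t) ^ m - u' * (u' / t') ^ m| ≤ (m + 1) * |u - u'| + m * |t - t'| := by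
  have ht : 0 ≤ t := hu.trans hut
  have ht' : 0 ≤ t' := hu'.trans hut'
  have mul_ratio : u / t * t = u := div_mul_cancel_of_imp fun h => le_antisymm (h ▸ hut) hu
  have mul_ratio' : u' / t' * t' = u' := div_mul_cancel_of_imp fun h => le_antisymm (h ▸ hut') hu'
  have hr0 : 0 ≤ u / t := div_nonneg hu ht
  have hr1 : u / t ≤ 1 := div_le_one_of_le₀ hut ht
  have hr0' : 0 ≤ u' / t' := div_nonneg hu' ht'
  have hr1' : u' / t' ≤ 1 := div_le_one_of_le₀ hut' ht'
  generalize u / t = r at *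
  generalize u' / t' = r' at *
  induction m with
  | zero => simp
  | succ m ih =>
    have key : u * r ^ (m + 1) - u' * r' ^ (m + 1)
        = (u * r ^ m - u' * r' ^ m) * r + r' ^ (m + 1) * (r * (t' - t) + (u - u')) := by
      linear_combination (-r' ^ m * r) * mul_ratio' + r' ^ (m + 1) * mul_ratio
    have first : |(u * r ^ m - u' * r' ^ m) * r| ≤ (m + 1) * |u - u'| + m * |t - t'| := by
      rw [abs_mul, abs_of_nonneg hr0]
      exact (mul_le_of_le_one_right (abs_nonneg _) hr1).trans ih
    have second : |r' ^ (m + 1) * (r * (t' - t) + (u - u'))| ≤ |t - t'| + |u - u'| := by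
      rw [abs_mul, abs_of_nonneg (pow_nonneg hr0' _)]
      refine (mul_le_of_le_one_left (abs_nonneg _) (pow_le_one₀ hr0' hr1')).trans ?_
      refine (abs_add_le _ _).trans ?_
      rw [abs_mul, abs_of_nonneg hr0, abs_sub_comm t' t]
      gcongr
      exact mul_le_of_le_one_left (abs_nonneg _) hr1
    rw [key]
    refine (abs_add_le _ _).trans ?_
    push_cast
    linarith

/-- In the subgraph setup with the map `Φ_c`: if `g₁, g₂` are Lipschitz on
`closure W`, then `Φ_c` is Lipschitz on `O₂` with some constant `L`. -/
theorem stmt6 (N m : ℕ) (hN : 2 ≤ N) (hm : 1 ≤ m)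
    (W : Set (EuclideanSpace ℝ (Fin (N - 1)))) (hWne : W.Nonempty)
    (hWbd : Bornology.IsBounded W) (hWcon : Convex ℝ W) (hWop : IsOpen W)
    (a D₁ D₂ : ℝ) (haD₂ : a < D₂) (hD₂D₁ : D₂ < D₁)
    (g₁ g₂ : EuclideanSpace ℝ (Fin (N - 1)) → ℝ)
    (hg₁c : Continuous g₁) (hg₂c : Continuous g₂)
    (hg₂ : ∀ x ∈ closure W, D₂ < g₂ x) (hg₁ : ∀ x ∈ closure W, g₁ x < D₁)
    (K₁ K₂ : NNReal)
    (hg₁lip : LipschitzOnWith K₁ g₁ (closure W))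
    (hg₂lip : LipschitzOnWith K₂ g₂ (closure W))
    (δ : ℝ) (hδ : δ = (D₂ - a) / (2 * (D₁ - D₂)))
    (c : ℝ) (hc : 1 / δ ≤ c)
    (g₃ g1c : EuclideanSpace ℝ (Fin (N - 1)) → ℝ)
    (hg₃ : ∀ x, g₃ x = g₂ x - δ * max (g₁ x - g₂ x) 0)
    (hg1c : ∀ x, g1c x = g₂ x + c * δ * max (g₁ x - g₂ x) 0)
    (O : (EuclideanSpace ℝ (Fin (N - 1)) → ℝ) →
      Set (EuclideanSpace ℝ (Fin (N - 1)) × ℝ))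
    (hO : ∀ g, O g = {p | p.1 ∈ W ∧ a < p.2 ∧ p.2 < g p.1})
    (h : EuclideanSpace ℝ (Fin (N - 1)) × ℝ → ℝ)
    (hh0 : ∀ p ∈ closure (O g₃), h p = 0)
    (hh1 : ∀ p ∈ closure (O g₂) \ closure (O g₃),
      h p = (p.2 - g₃ p.1) ^ (m + 1) / (δ ^ m * (g₁ p.1 - g₂ p.1) ^ m))
    (Φc : EuclideanSpace ℝ (Fin (N - 1)) × ℝ → EuclideanSpace ℝ (Fin (N - 1)) × ℝ)
    (hΦc : ∀ p, Φc p = (p.1, p.2 + c * h p)) :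
    ∃ L : NNReal, LipschitzOnWith L Φc (O g₂) := by
  have hD : 0 < D₁ - D₂ := sub_pos.2 hD₂D₁
  have hδ0 : 0 < δ := hδ ▸ div_pos (sub_pos.2 haD₂) (by linarith)
  have hg₃c : Continuous g₃ := by
    rw [funext hg₃]
    fun_prop
  have hclosure : ∀ p ∈ closure (O g₃), p.2 ≤ g₃ p.1 := by
    have hclosed : IsClosed {p : EuclideanSpace ℝ (Fin (N - 1)) × ℝ | p.2 ≤ g₃ p.1} :=
      isClosed_le continuous_snd (hg₃c.comp continuous_fst)
    refine fun p hp => closure_minimal ?_ hclosed hp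
    intro q hq
    rw [hO] at hq
    exact hq.2.2.le
  set t : EuclideanSpace ℝ (Fin (N - 1)) → ℝ := fun x => δ * max (g₁ x - g₂ x) 0 with ht
  set u : EuclideanSpace ℝ (Fin (N - 1)) × ℝ → ℝ := fun p => max (p.2 - g₃ p.1) 0 with hu
  have ht0 : ∀ x, 0 ≤ t x := fun x => mul_nonneg hδ0.le (le_max_right _ _)
  have hg₃t : ∀ x, g₃ x = g₂ x - t x := hg₃
  have hu0 : ∀ p, 0 ≤ u p := fun p => le_max_right _ _
  have hut : ∀ p ∈ O g₂, u p ≤ t p.1 := by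
    intro p hp
    rw [hO] at hp
    have := hp.2.2
    exact max_le (by rw [hg₃t]; linarith) (ht0 _)
  have hh : ∀ p ∈ O g₂, h p = u p * (u p / t p.1) ^ m := by
    intro p hp
    by_cases hc₃ : p ∈ closure (O g₃)
    · have : u p = 0 := max_eq_right (sub_nonpos.2 (hclosure p hc₃))
      rw [hh0 p hc₃, this, zero_mul]
    · have hp' := hp
      rw [hO] at hp'
      have hle : g₃ p.1 ≤ p.2 := by
        by_contra! hlt
        refine hc₃ (subset_closure ?_)
        rw [hO]
        exact ⟨hp'.1, hp'.2.1, hlt⟩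
      have hup : u p = p.2 - g₃ p.1 := max_eq_left (sub_nonneg.2 hle)
      have hpos : 0 < g₁ p.1 - g₂ p.1 := by
        by_contra! hnp
        have h1 := hg₃ p.1
        rw [max_eq_right hnp] at h1
        linarith [hp'.2.2]
      have htp : t p.1 = δ * (g₁ p.1 - g₂ p.1) := by
        simp only [ht]
        rw [max_eq_left hpos.le]
      rw [hh1 p ⟨subset_closure hp, hc₃⟩, ← hup, htp, div_pow, mul_pow, pow_succ']
      exact mul_div_assoc _ _ _
  set T : ℝ := δ * (K₁ + K₂) with hT
  set U : ℝ := 1 + K₂ + T with hU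
  set H : ℝ := (m + 1) * U + m * T with hH
  have hT0 : 0 ≤ T := by positivity
  have hU0 : 0 ≤ U := by positivity
  have hH0 : 0 ≤ H := by positivity
  refine ⟨Real.toNNReal (1 + |c| * H), LipschitzOnWith.of_dist_le_mul ?_⟩
  intro p hp q hq
  rw [Real.coe_toNNReal _ (by positivity)]
  have hpW : p.1 ∈ closure W := by
    rw [hO] at hp
    exact subset_closure hp.1
  have hqW : q.1 ∈ closure W := by
    rw [hO] at hq
    exact subset_closure hq.1
  have hfst : dist p.1 q.1 ≤ dist p q := le_max_left _ _
  have hsnd : |p.2 - q.2| ≤ dist p q := le_max_right (dist p.1 q.1) (dist p.2 q.2)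
  have h₁ : |g₁ p.1 - g₁ q.1| ≤ K₁ * dist p q :=
    (hg₁lip.dist_le_mul _ hpW _ hqW).trans (by gcongr)
  have h₂ : |g₂ p.1 - g₂ q.1| ≤ K₂ * dist p q :=
    (hg₂lip.dist_le_mul _ hpW _ hqW).trans (by gcongr)
  have hTlip : |t p.1 - t q.1| ≤ T * dist p q := by
    simp only [ht, hT]
    rw [← mul_sub, abs_mul, abs_of_pos hδ0, mul_assoc]
    gcongr
    refine (abs_max_sub_max_le_abs _ _ _).trans ?_
    rw [abs_le] at *
    constructor <;> linarith
  have hUlip : |u p - u q| ≤ U * dist p q := by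
    refine (abs_max_sub_max_le_abs _ _ _).trans ?_
    rw [hg₃t, hg₃t, hU]
    rw [abs_le] at *
    constructor <;> linarith
  have hHlip : |h p - h q| ≤ H * dist p q := by
    rw [hh p hp, hh q hq]
    refine (abs_mul_div_pow_sub_le m (hu0 p) (hut p hp) (hu0 q) (hut q hq)).trans ?_
    calc _ ≤ (m + 1) * (U * dist p q) + m * (T * dist p q) := by gcongr
      _ = H * dist p q := by rw [hH]; ring
  have hd : 0 ≤ dist p q := dist_nonneg
  rw [hΦc, hΦc, Prod.dist_eq]
  refine max_le ?_ ?_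
  · exact hfst.trans (le_mul_of_one_le_left hd (le_add_of_nonneg_right (by positivity)))
  · calc |p.2 + c * h p - (q.2 + c * h q)|
        = |(p.2 - q.2) + c * (h p - h q)| := by ring_nf
      _ ≤ |p.2 - q.2| + |c| * |h p - h q| := by
        rw [← abs_mul]
        exact abs_add_le _ _
      _ ≤ dist p q + |c| * (H * dist p q) := by gcongr
      _ = (1 + |c| * H) * dist p q := by ring
end

section
/- In the subgraph setup with the map Φ_c: if m ≥ 2 and in addition g₁ and g₂ are of class C^{m−1} on the open set W (in the sense of ContDiffOn of order m−1), then Φ_c is of class C^{m−1} on the open set O₂ (ContDiffOn of order m−1 on O₂). -/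
open Set

open Filter Topology in
theorem hasDerivAt_max_zero_pow (n : ℕ) (x : ℝ) :
    HasDerivAt (fun y : ℝ => max y 0 ^ (n + 2)) ((n + 2 : ℝ) * max x 0 ^ (n + 1)) x := by
  rcases lt_trichotomy x 0 with hx | rfl | hx
  · have e : (fun y : ℝ => max y 0 ^ (n + 2)) =ᶠ[𝓝 x] fun _ => 0 := by
      filter_upwards [eventually_lt_nhds hx] with y hy
      simp [max_eq_right hy.le]
    simpa [max_eq_right hx.le] using (hasDerivAt_const x (0 : ℝ)).congr_of_eventuallyEq e
  · have hO : (fun y : ℝ => max y 0 ^ (n + 2)) =O[𝓝 0] fun y : ℝ => ‖y - 0‖ ^ (n + 2) := by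
      refine Asymptotics.IsBigO.of_bound 1 (Eventually.of_forall fun y => ?_)
      simp only [norm_pow, sub_zero, one_mul, Real.norm_eq_abs]
      gcongr
      exact max_le (le_abs_self y) (abs_nonneg y)
    simpa using (hO.hasFDerivAt (𝕜 := ℝ) (by omega)).hasDerivAt
  · have e : (fun y : ℝ => max y 0 ^ (n + 2)) =ᶠ[𝓝 x] fun y => y ^ (n + 2) := by
      filter_upwards [eventually_gt_nhds hx] with y hy
      rw [max_eq_left hy.le]
    have := (hasDerivAt_pow (n + 2) x).congr_of_eventuallyEq e
    simpa [max_eq_left hx.le] using this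

theorem contDiff_max_zero_pow (n : ℕ) :
    ContDiff ℝ n (fun y : ℝ => max y 0 ^ (n + 1)) := by
  induction n with
  | zero => exact contDiff_zero.2 (by fun_prop)
  | succ n ih =>
    push_cast
    refine contDiff_succ_iff_deriv.2
      ⟨fun x => (hasDerivAt_max_zero_pow n x).differentiableAt, by simp, ?_⟩
    have e : deriv (fun y : ℝ => max y 0 ^ (n + 1 + 1)) =
        fun x => (n + 2 : ℝ) * max x 0 ^ (n + 1) :=
      funext fun x => (hasDerivAt_max_zero_pow n x).deriv
    rw [e]
    exact contDiff_const.mul ih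

/-- In the subgraph setup with the map `Φ_c`: if `m ≥ 2` and `g₁, g₂` are of class
`C^{m−1}` on `W`, then `Φ_c` is of class `C^{m−1}` on `O₂`. -/
theorem stmt7 (N m : ℕ) (hN : 2 ≤ N) (hm : 2 ≤ m)
    (W : Set (EuclideanSpace ℝ (Fin (N - 1)))) (hWne : W.Nonempty)
    (hWbd : Bornology.IsBounded W) (hWcon : Convex ℝ W) (hWop : IsOpen W)
    (a D₁ D₂ : ℝ) (haD₂ : a < D₂) (hD₂D₁ : D₂ < D₁)
    (g₁ g₂ : EuclideanSpace ℝ (Fin (N - 1)) → ℝ)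
    (hg₁c : Continuous g₁) (hg₂c : Continuous g₂)
    (hg₂ : ∀ x ∈ closure W, D₂ < g₂ x) (hg₁ : ∀ x ∈ closure W, g₁ x < D₁)
    (hg₁sm : ContDiffOn ℝ (m - 1 : ℕ) g₁ W)
    (hg₂sm : ContDiffOn ℝ (m - 1 : ℕ) g₂ W)
    (δ : ℝ) (hδ : δ = (D₂ - a) / (2 * (D₁ - D₂)))
    (c : ℝ) (hc : 1 / δ ≤ c)
    (g₃ g1c : EuclideanSpace ℝ (Fin (N - 1)) → ℝ)
    (hg₃ : ∀ x, g₃ x = g₂ x - δ * max (g₁ x - g₂ x) 0)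
    (hg1c : ∀ x, g1c x = g₂ x + c * δ * max (g₁ x - g₂ x) 0)
    (O : (EuclideanSpace ℝ (Fin (N - 1)) → ℝ) →
      Set (EuclideanSpace ℝ (Fin (N - 1)) × ℝ))
    (hO : ∀ g, O g = {p | p.1 ∈ W ∧ a < p.2 ∧ p.2 < g p.1})
    (h : EuclideanSpace ℝ (Fin (N - 1)) × ℝ → ℝ)
    (hh0 : ∀ p ∈ closure (O g₃), h p = 0)
    (hh1 : ∀ p ∈ closure (O g₂) \ closure (O g₃),
      h p = (p.2 - g₃ p.1) ^ (m + 1) / (δ ^ m * (g₁ p.1 - g₂ p.1) ^ m))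
    (Φc : EuclideanSpace ℝ (Fin (N - 1)) × ℝ → EuclideanSpace ℝ (Fin (N - 1)) × ℝ)
    (hΦc : ∀ p, Φc p = (p.1, p.2 + c * h p)) :
    ContDiffOn ℝ (m - 1 : ℕ) Φc (O g₂) := by
  have hδpos : 0 < δ := by
    rw [hδ]
    exact div_pos (by linarith) (by linarith)
  have hg₃c : Continuous g₃ := by
    rw [funext hg₃]
    fun_prop
  have hOop : IsOpen (O g₂) := by
    rw [hO]
    exact (hWop.preimage continuous_fst).inter
      ((isOpen_lt continuous_const continuous_snd).inter
        (isOpen_lt continuous_snd (hg₂c.comp continuous_fst)))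
  have h_below : ∀ p ∈ O g₂, p.2 ≤ g₃ p.1 → h p = 0 := by
    intro p hp hle
    rw [hO] at hp
    obtain ⟨hpW, hpa, -⟩ := hp
    apply hh0
    have hmem : p.2 ∈ closure (Ioo a p.2) := by
      rw [closure_Ioo hpa.ne]
      exact right_mem_Icc.2 hpa.le
    have hmaps : MapsTo (fun t : ℝ => (p.1, t)) (Ioo a p.2) (O g₃) := by
      intro t ht
      rw [hO]
      exact ⟨hpW, ht.1, ht.2.trans_le hle⟩
    exact hmaps.closure (by fun_prop) hmem
  have h_above : ∀ p ∈ O g₂, g₃ p.1 < p.2 →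
      h p = (p.2 - g₃ p.1) ^ (m + 1) / (δ ^ m * (g₁ p.1 - g₂ p.1) ^ m) := by
    intro p hp hlt
    refine hh1 p ⟨subset_closure hp, fun hcl => hlt.not_ge ?_⟩
    have hsub : O g₃ ⊆ {q | q.2 ≤ g₃ q.1} := by
      rw [hO]
      exact fun q hq => hq.2.2.le
    exact closure_minimal hsub
      (isClosed_le continuous_snd (hg₃c.comp continuous_fst)) hcl
  rw [funext hΦc]
  refine contDiffOn_fst.prodMk (contDiffOn_snd.add (contDiffOn_const.mul ?_))
  intro p hp
  refine ContDiffAt.contDiffWithinAt ?_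
  have hp' := hp
  rw [hO] at hp'
  obtain ⟨hpW, -, hp₂⟩ := hp'
  rcases le_or_gt (g₁ p.1) (g₂ p.1) with hu | hu
  · have hlt : p.2 < g₃ p.1 := by
      rw [hg₃, max_eq_right (by linarith)]
      linarith
    have e : h =ᶠ[nhds p] fun _ => 0 := by
      filter_upwards [hOop.mem_nhds hp,
        (isOpen_lt continuous_snd (hg₃c.comp continuous_fst)).mem_nhds hlt] with q hq hq'
      exact h_below q hq (le_of_lt hq')
    exact contDiffAt_const.congr_of_eventuallyEq e
  · have e : h =ᶠ[nhds p] fun q =>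
        max (q.2 - (g₂ q.1 - δ * (g₁ q.1 - g₂ q.1))) 0 ^ (m + 1) /
          (δ ^ m * (g₁ q.1 - g₂ q.1) ^ m) := by
      filter_upwards [hOop.mem_nhds hp,
        (isOpen_lt (hg₂c.comp continuous_fst) (hg₁c.comp continuous_fst)).mem_nhds hu]
        with q hq hq'
      have hq'' : g₂ q.1 < g₁ q.1 := hq'
      have hq₃ : g₂ q.1 - δ * (g₁ q.1 - g₂ q.1) = g₃ q.1 := by
        rw [hg₃, max_eq_left (by linarith)]
      rw [hq₃]
      rcases le_or_gt q.2 (g₃ q.1) with hle | hlt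
      · rw [h_below q hq hle, max_eq_right (by linarith)]
        simp
      · rw [h_above q hq hlt, max_eq_left (by linarith)]
    refine ContDiffAt.congr_of_eventuallyEq ?_ e
    have h₁ : ContDiffAt ℝ (m - 1 : ℕ)
        (fun q : EuclideanSpace ℝ (Fin (N - 1)) × ℝ => g₁ q.1) p :=
      (hg₁sm.contDiffAt (hWop.mem_nhds hpW)).comp p contDiffAt_fst
    have h₂ : ContDiffAt ℝ (m - 1 : ℕ)
        (fun q : EuclideanSpace ℝ (Fin (N - 1)) × ℝ => g₂ q.1) p :=
      (hg₂sm.contDiffAt (hWop.mem_nhds hpW)).comp p contDiffAt_fst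
    have hpow : ContDiff ℝ (m - 1 : ℕ) (fun y : ℝ => max y 0 ^ (m + 1)) :=
      (contDiff_max_zero_pow m).of_le (by exact_mod_cast Nat.sub_le m 1)
    refine ContDiffAt.div ?_ (contDiffAt_const.mul ((h₁.sub h₂).pow m)) ?_
    · exact hpow.contDiffAt.comp p
        (contDiffAt_snd.sub (h₂.sub (contDiffAt_const.mul (h₁.sub h₂))))
    · exact mul_ne_zero (pow_ne_zero _ hδpos.ne') (pow_ne_zero _ (sub_pos.2 hu).ne')
end

section
/- In the subgraph setup with the function h: assume in addition that g₁ and g₂ are of class C^m on ℝ^{N−1} and that there is B > 0 with ‖D^k g_i(x̄)‖ ≤ B for i = 1, 2, all x̄ ∈ W and all 1 ≤ k ≤ m (k-th Fréchet derivatives). Then there exists M > 0 such that for every x ∈ O₂ \ closure(O₃) and every integer k with 1 ≤ k ≤ m one has h(x)^{k−1} · ‖D^k h(x)‖ ≤ M, where D^k h denotes the k-th Fréchet derivative of h on the open set O₂ \ closure(O₃) (on which h is of class C^m, since g₁ > g₂ there). -/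
open Set

section HomogeneousQuotient

variable {E F : Type*} [NormedAddCommGroup E] [NormedSpace ℝ E]
  [NormedAddCommGroup F] [NormedSpace ℝ F]

lemma norm_iteratedFDeriv_comp_fst_le {g : E → ℝ} {n : WithTop ℕ∞} (hg : ContDiff ℝ n g)
    {i : ℕ} (hi : i ≤ n) (p : E × F) :
    ‖iteratedFDeriv ℝ i (fun q : E × F ↦ g q.1) p‖ ≤ ‖iteratedFDeriv ℝ i g p.1‖ := by
  have key := (ContinuousLinearMap.fst ℝ E F).iteratedFDeriv_comp_right hg p hi
  have hc : g ∘ ContinuousLinearMap.fst ℝ E F = fun q : E × F ↦ g q.1 := rfl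
  rw [hc] at key
  rw [key]
  refine (ContinuousMultilinearMap.norm_compContinuousLinearMap_le _ _).trans ?_
  refine mul_le_of_le_one_right (norm_nonneg _) ?_
  exact Finset.prod_le_one (fun _ _ ↦ norm_nonneg _)
    fun _ _ ↦ ContinuousLinearMap.norm_fst_le ℝ E F

lemma norm_iteratedFDeriv_clm_le (L : E →L[ℝ] F) {i : ℕ} (hi : 1 ≤ i) (p : E) :
    ‖iteratedFDeriv ℝ i L p‖ ≤ ‖L‖ := by
  obtain ⟨j, rfl⟩ := Nat.exists_eq_add_of_le' hi
  rw [← norm_iteratedFDeriv_fderiv]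
  have hL : fderiv ℝ (L : E → F) = fun _ ↦ L := funext fun _ ↦ L.fderiv
  rw [hL]
  rcases Nat.eq_zero_or_pos j with rfl | hj
  · simp
  · rw [iteratedFDeriv_const_of_ne hj.ne']
    simp

lemma norm_iteratedFDeriv_const_smul_add_const_smul_le {f g : E → F} {i : ℕ}
    (hf : ContDiff ℝ i f) (hg : ContDiff ℝ i g) (a b : ℝ) {B : ℝ} {x : E}
    (hfB : ‖iteratedFDeriv ℝ i f x‖ ≤ B) (hgB : ‖iteratedFDeriv ℝ i g x‖ ≤ B) :
    ‖iteratedFDeriv ℝ i (a • f + b • g) x‖ ≤ (|a| + |b|) * B := by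
  have haf : ContDiff ℝ i (a • f) := hf.const_smul a
  have hbg : ContDiff ℝ i (b • g) := hg.const_smul b
  rw [iteratedFDeriv_add_apply haf.contDiffAt hbg.contDiffAt,
    iteratedFDeriv_const_smul_apply hf.contDiffAt,
    iteratedFDeriv_const_smul_apply hg.contDiffAt]
  refine (norm_add_le _ _).trans ?_
  rw [norm_smul, norm_smul, Real.norm_eq_abs, Real.norm_eq_abs, add_mul]
  gcongr

/-- The quotient `u ^ (m + 1) / w ^ m` is homogeneous of degree one in `(u, w)`, so its `k`-th
derivative is of size at most `w ^ (1 - k)` wherever `0 ≤ u ≤ w`. -/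
lemma exists_pow_mul_norm_iteratedFDerivWithin_pow_div_pow_le {m : ℕ} {s : Set E} (hs : IsOpen s)
    {u w : E → ℝ} (hu : ContDiff ℝ m u) (hw : ContDiff ℝ m w) {A : ℝ}
    (hu0 : ∀ x ∈ s, 0 ≤ u x) (huw : ∀ x ∈ s, u x ≤ w x) (hw0 : ∀ x ∈ s, 0 < w x)
    (hwA : ∀ x ∈ s, w x ≤ A)
    (huA : ∀ x ∈ s, ∀ k : ℕ, 1 ≤ k → k ≤ m → ‖iteratedFDeriv ℝ k u x‖ ≤ A)
    (hwA' : ∀ x ∈ s, ∀ k : ℕ, 1 ≤ k → k ≤ m → ‖iteratedFDeriv ℝ k w x‖ ≤ A) :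
    ∃ M : ℝ, 0 < M ∧ ∀ x ∈ s, ∀ k : ℕ, 1 ≤ k → k ≤ m →
      w x ^ (k - 1) *
        ‖iteratedFDerivWithin ℝ k (fun y ↦ u y ^ (m + 1) / w y ^ m) s x‖ ≤ M := by
  set G : ℝ × ℝ → ℝ := fun z ↦ z.1 ^ (m + 1) / z.2 ^ m with hG
  set T : Set (ℝ × ℝ) := {z | 0 < z.2} with hT
  have hTo : IsOpen T := isOpen_lt continuous_const continuous_snd
  have hGs : ContDiffOn ℝ m G T :=
    (contDiff_fst.pow _).contDiffOn.div (contDiff_snd.pow _).contDiffOn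
      fun z hz ↦ pow_ne_zero _ (ne_of_gt hz)
  have hbd : ∀ i : ℕ, ∃ C : ℝ, i ≤ m → ∀ z ∈ Icc (0 : ℝ) 1 ×ˢ ({1} : Set ℝ),
      ‖iteratedFDerivWithin ℝ i G T z‖ ≤ C := by
    intro i
    by_cases hi : i ≤ m
    · have hc := hGs.continuousOn_iteratedFDerivWithin (m := i) (by exact_mod_cast hi)
        hTo.uniqueDiffOn
      obtain ⟨C, hC⟩ := (isCompact_Icc.prod isCompact_singleton).exists_bound_of_continuousOn
        (hc.mono (s := T) (t := Icc (0 : ℝ) 1 ×ˢ ({1} : Set ℝ)) (by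
          rintro ⟨z₁, z₂⟩ ⟨-, rfl⟩
          simp [hT]))
      exact ⟨C, fun _ ↦ hC⟩
    · exact ⟨0, fun h ↦ absurd h hi⟩
  choose C hC using hbd
  set C₀ : ℝ := 1 + ∑ i ∈ Finset.range (m + 1), |C i| with hC₀
  have hC₀1 : 1 ≤ C₀ := le_add_of_nonneg_right (Finset.sum_nonneg fun _ _ ↦ abs_nonneg _)
  have hCle : ∀ i ≤ m, C i ≤ C₀ := fun i hi ↦ by
    have := Finset.single_le_sum (f := fun i ↦ |C i|) (fun _ _ ↦ abs_nonneg _)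
      (Finset.mem_range.2 (Nat.lt_succ_of_le hi))
    have h2 := le_abs_self (C i)
    linarith
  set L : ℝ := max 1 A with hL
  have hL1 : 1 ≤ L := le_max_left _ _
  refine ⟨m.factorial * C₀ * L ^ m, by positivity, fun x hx k hk hkm ↦ ?_⟩
  have hwx := hw0 x hx
  have hkm' : (k : WithTop ℕ∞) ≤ m := by exact_mod_cast hkm
  set f : E → ℝ × ℝ := fun y ↦ (w x)⁻¹ • (u y, w y) with hf
  have huw_s : ContDiff ℝ m fun y ↦ (u y, w y) := hu.prodMk hw
  have hfs : ContDiff ℝ m f := huw_s.const_smul _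
  have hmaps : MapsTo f s T := fun y hy ↦ by
    have := hw0 y hy
    simp only [hT, hf, mem_ofPred_eq, Prod.smul_snd, smul_eq_mul]
    positivity
  have hcomp : ‖iteratedFDerivWithin ℝ k (G ∘ f) s x‖ ≤ k.factorial * C₀ * (L / w x) ^ k := by
    refine norm_iteratedFDerivWithin_comp_le hGs hfs.contDiffOn hkm' hTo.uniqueDiffOn
      hs.uniqueDiffOn hmaps hx (fun i hi ↦ ?_) (fun i hi hik ↦ ?_)
    · refine (hC i (hi.trans hkm) _ ?_).trans (hCle i (hi.trans hkm))
      have h0 := hu0 x hx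
      have h1 := huw x hx
      refine ⟨⟨?_, ?_⟩, ?_⟩
      · simp only [hf, Prod.smul_fst, smul_eq_mul]
        positivity
      · simp only [hf, Prod.smul_fst, smul_eq_mul]
        rwa [inv_mul_le_iff₀ hwx, mul_one]
      · simp [hf, hwx.ne']
    · have him : i ≤ m := hik.trans hkm
      have him' : (i : WithTop ℕ∞) ≤ m := by exact_mod_cast him
      rw [iteratedFDerivWithin_of_isOpen i hs hx, hf,
        iteratedFDeriv_const_smul_apply' (huw_s.of_le him').contDiffAt,
        iteratedFDeriv_prodMk hu.contDiffAt hw.contDiffAt him', norm_smul,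
        ContinuousMultilinearMap.opNorm_prod, Real.norm_of_nonneg (inv_nonneg.2 hwx.le)]
      have h1 : 1 ≤ L / w x := (one_le_div hwx).2 ((hwA x hx).trans (le_max_right _ _))
      calc (w x)⁻¹ * max ‖iteratedFDeriv ℝ i u x‖ ‖iteratedFDeriv ℝ i w x‖
          ≤ (w x)⁻¹ * L := by
            gcongr
            exact (max_le (huA x hx i hi him) (hwA' x hx i hi him)).trans (le_max_right _ _)
        _ = L / w x := by ring
        _ ≤ (L / w x) ^ i := le_self_pow₀ h1 (by omega)
  have hscale : ∀ y ∈ s, u y ^ (m + 1) / w y ^ m = (w x • (G ∘ f)) y := fun y hy ↦ by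
    have := hw0 y hy
    simp only [hG, hf, Pi.smul_apply, Function.comp_apply, Prod.smul_fst, Prod.smul_snd,
      smul_eq_mul, mul_pow, inv_pow]
    field_simp
    ring
  rw [iteratedFDerivWithin_congr hscale hx,
    iteratedFDerivWithin_const_smul_apply
      ((hGs.comp hfs.contDiffOn hmaps).of_le hkm' x hx) hs.uniqueDiffOn hx,
    norm_smul, Real.norm_of_nonneg hwx.le, ← mul_assoc, ← pow_succ, Nat.sub_add_cancel hk]
  calc w x ^ k * ‖iteratedFDerivWithin ℝ k (G ∘ f) s x‖
      ≤ w x ^ k * (k.factorial * C₀ * (L / w x) ^ k) := by gcongr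
    _ = k.factorial * C₀ * L ^ k := by
      rw [div_pow]
      field_simp
    _ ≤ m.factorial * C₀ * L ^ m := by gcongr

end HomogeneousQuotient

/-- In the subgraph setup with the function `h`: if `g₁, g₂` are of class `C^m` with
derivatives up to order `m` bounded by `B` on `W`, then there is `M > 0` such that
`h(x)^{k−1}·‖D^k h(x)‖ ≤ M` on `O₂ \ closure O₃` for all `1 ≤ k ≤ m`. -/
theorem stmt8 (N m : ℕ) (hN : 2 ≤ N) (hm : 1 ≤ m)
    (W : Set (EuclideanSpace ℝ (Fin (N - 1)))) (hWne : W.Nonempty)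
    (hWbd : Bornology.IsBounded W) (hWcon : Convex ℝ W) (hWop : IsOpen W)
    (a D₁ D₂ : ℝ) (haD₂ : a < D₂) (hD₂D₁ : D₂ < D₁)
    (g₁ g₂ : EuclideanSpace ℝ (Fin (N - 1)) → ℝ)
    (hg₁c : Continuous g₁) (hg₂c : Continuous g₂)
    (hg₂ : ∀ x ∈ closure W, D₂ < g₂ x) (hg₁ : ∀ x ∈ closure W, g₁ x < D₁)
    (hg₁sm : ContDiff ℝ (m : ℕ∞) g₁) (hg₂sm : ContDiff ℝ (m : ℕ∞) g₂)
    (B : ℝ) (hB : 0 < B)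
    (hg₁bd : ∀ x ∈ W, ∀ k : ℕ, 1 ≤ k → k ≤ m → ‖iteratedFDeriv ℝ k g₁ x‖ ≤ B)
    (hg₂bd : ∀ x ∈ W, ∀ k : ℕ, 1 ≤ k → k ≤ m → ‖iteratedFDeriv ℝ k g₂ x‖ ≤ B)
    (δ : ℝ) (hδ : δ = (D₂ - a) / (2 * (D₁ - D₂)))
    (g₃ : EuclideanSpace ℝ (Fin (N - 1)) → ℝ)
    (hg₃ : ∀ x, g₃ x = g₂ x - δ * max (g₁ x - g₂ x) 0)
    (O : (EuclideanSpace ℝ (Fin (N - 1)) → ℝ) →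
      Set (EuclideanSpace ℝ (Fin (N - 1)) × ℝ))
    (hO : ∀ g, O g = {p | p.1 ∈ W ∧ a < p.2 ∧ p.2 < g p.1})
    (h : EuclideanSpace ℝ (Fin (N - 1)) × ℝ → ℝ)
    (hh0 : ∀ p ∈ closure (O g₃), h p = 0)
    (hh1 : ∀ p ∈ closure (O g₂) \ closure (O g₃),
      h p = (p.2 - g₃ p.1) ^ (m + 1) / (δ ^ m * (g₁ p.1 - g₂ p.1) ^ m)) :
    ∃ M : ℝ, 0 < M ∧
      ∀ x ∈ O g₂ \ closure (O g₃), ∀ k : ℕ, 1 ≤ k → k ≤ m →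
        h x ^ (k - 1) *
          ‖iteratedFDerivWithin ℝ k h (O g₂ \ closure (O g₃)) x‖ ≤ M := by
  have hδ0 : 0 < δ := hδ ▸ div_pos (by linarith) (by linarith)
  have hδm : δ * (D₁ - D₂) = (D₂ - a) / 2 := by
    have : D₁ - D₂ ≠ 0 := by linarith
    rw [hδ]
    field_simp
  set U := O g₂ \ closure (O g₃) with hU
  have hUo : IsOpen U := by
    refine IsOpen.sdiff ?_ isClosed_closure
    rw [hO]
    exact (hWop.preimage continuous_fst).inter
      ((isOpen_lt continuous_const continuous_snd).inter
        (isOpen_lt continuous_snd (hg₂c.comp continuous_fst)))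
  have hUW : ∀ p ∈ U, p.1 ∈ W ∧ a < p.2 ∧ p.2 < g₂ p.1 := fun p hp ↦ by
    have := hp.1
    rwa [hO] at this
  have hUg₃ : ∀ p ∈ U, g₃ p.1 ≤ p.2 := fun p hp ↦ by
    by_contra! hlt
    refine hp.2 (subset_closure ?_)
    rw [hO]
    exact ⟨(hUW p hp).1, (hUW p hp).2.1, hlt⟩
  have hUg : ∀ p ∈ U, 0 < g₁ p.1 - g₂ p.1 := fun p hp ↦ by
    by_contra! hle
    have h1 := hUg₃ p hp
    rw [hg₃, max_eq_right hle] at h1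
    linarith [(hUW p hp).2.2]
  have hUg₃' : ∀ p ∈ U, g₃ p.1 = g₂ p.1 - δ * (g₁ p.1 - g₂ p.1) := fun p hp ↦ by
    rw [hg₃, max_eq_left (hUg p hp).le]
  set v : EuclideanSpace ℝ (Fin (N - 1)) → ℝ := δ • g₁ + (-(1 + δ)) • g₂ with hv
  set d : EuclideanSpace ℝ (Fin (N - 1)) → ℝ := δ • g₁ + (-δ) • g₂ with hd
  have hdg : ∀ x, d x = δ * (g₁ x - g₂ x) := fun x ↦ by
    simp only [hd, Pi.add_apply, Pi.smul_apply, smul_eq_mul]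
    ring
  have hvg : ∀ p ∈ U, v p.1 = -g₃ p.1 := fun p hp ↦ by
    rw [hUg₃' p hp]
    simp only [hv, Pi.add_apply, Pi.smul_apply, smul_eq_mul]
    ring
  have hg₁m : ContDiff ℝ m g₁ := by exact_mod_cast hg₁sm
  have hg₂m : ContDiff ℝ m g₂ := by exact_mod_cast hg₂sm
  have hvm : ContDiff ℝ m v := (hg₁m.const_smul δ).add (hg₂m.const_smul (-(1 + δ)))
  have hdm : ContDiff ℝ m d := (hg₁m.const_smul δ).add (hg₂m.const_smul (-δ))
  have hbd : ∀ α β : ℝ, ∀ x ∈ W, ∀ k : ℕ, 1 ≤ k → k ≤ m →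
      ‖iteratedFDeriv ℝ k (α • g₁ + β • g₂) x‖ ≤ (|α| + |β|) * B := fun α β x hx k hk hkm ↦
    norm_iteratedFDeriv_const_smul_add_const_smul_le
      (hg₁m.of_le (by exact_mod_cast hkm)) (hg₂m.of_le (by exact_mod_cast hkm)) α β
      (hg₁bd x hx k hk hkm) (hg₂bd x hx k hk hkm)
  set A : ℝ := (D₂ - a) / 2 + 1 + (1 + 2 * δ) * B with hA
  have hu₀ : ∀ p ∈ U, 0 ≤ p.2 + v p.1 := fun p hp ↦ by
    rw [hvg p hp]
    linarith [hUg₃ p hp]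
  have hud : ∀ p ∈ U, p.2 + v p.1 ≤ d p.1 := fun p hp ↦ by
    rw [hvg p hp, hUg₃' p hp, hdg]
    linarith [(hUW p hp).2.2]
  have hd₀ : ∀ p ∈ U, 0 < d p.1 := fun p hp ↦ by
    rw [hdg]
    exact mul_pos hδ0 (hUg p hp)
  have hdA : ∀ p ∈ U, d p.1 ≤ A := fun p hp ↦ by
    have h1 := hg₁ p.1 (subset_closure (hUW p hp).1)
    have h2 := hg₂ p.1 (subset_closure (hUW p hp).1)
    have h3 : δ * (g₁ p.1 - g₂ p.1) ≤ δ * (D₁ - D₂) := by gcongr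
    have h4 : 0 ≤ (1 + 2 * δ) * B := by positivity
    rw [hdg, hA]
    linarith
  have huA : ∀ p ∈ U, ∀ k : ℕ, 1 ≤ k → k ≤ m →
      ‖iteratedFDeriv ℝ k
        (fun q : EuclideanSpace ℝ (Fin (N - 1)) × ℝ ↦ q.2 + v q.1) p‖ ≤ A := by
    intro p hp k hk hkm
    have hkm' : (k : WithTop ℕ∞) ≤ m := by exact_mod_cast hkm
    have hvf : ContDiff ℝ k
        (fun q : EuclideanSpace ℝ (Fin (N - 1)) × ℝ ↦ v q.1) :=
      (hvm.of_le hkm').comp contDiff_fst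
    have hsum : (fun q : EuclideanSpace ℝ (Fin (N - 1)) × ℝ ↦ q.2 + v q.1) =
        ⇑(ContinuousLinearMap.snd ℝ (EuclideanSpace ℝ (Fin (N - 1))) ℝ) +
          fun q : EuclideanSpace ℝ (Fin (N - 1)) × ℝ ↦ v q.1 := rfl
    rw [hsum, iteratedFDeriv_add_apply (ContinuousLinearMap.contDiff _).contDiffAt
      hvf.contDiffAt]
    have h1 := (norm_iteratedFDeriv_clm_le
      (ContinuousLinearMap.snd ℝ (EuclideanSpace ℝ (Fin (N - 1))) ℝ) hk p).trans
      (ContinuousLinearMap.norm_snd_le ℝ (EuclideanSpace ℝ (Fin (N - 1))) ℝ)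
    have h2 := norm_iteratedFDeriv_comp_fst_le (F := ℝ) hvm hkm' p
    have h3 := hbd δ (-(1 + δ)) p.1 (hUW p hp).1 k hk hkm
    rw [abs_neg, abs_of_pos hδ0, abs_of_pos (by linarith : 0 < 1 + δ)] at h3
    refine (norm_add_le _ _).trans ?_
    rw [hA]
    linarith [h2.trans h3]
  have hdA' : ∀ p ∈ U, ∀ k : ℕ, 1 ≤ k → k ≤ m →
      ‖iteratedFDeriv ℝ k
        (fun q : EuclideanSpace ℝ (Fin (N - 1)) × ℝ ↦ d q.1) p‖ ≤ A := by
    intro p hp k hk hkm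
    have h2 := norm_iteratedFDeriv_comp_fst_le (F := ℝ) hdm
      (by exact_mod_cast hkm : (k : WithTop ℕ∞) ≤ m) p
    have h3 := hbd δ (-δ) p.1 (hUW p hp).1 k hk hkm
    rw [abs_neg, abs_of_pos hδ0] at h3
    rw [hA]
    linarith [h2.trans h3]
  obtain ⟨M, hM0, hM⟩ := exists_pow_mul_norm_iteratedFDerivWithin_pow_div_pow_le hUo
    (contDiff_snd.add (hvm.comp contDiff_fst)) (hdm.comp contDiff_fst) hu₀ hud hd₀ hdA huA hdA'
  have hh : ∀ p ∈ U, h p = (p.2 + v p.1) ^ (m + 1) / d p.1 ^ m := fun p hp ↦ by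
    rw [hh1 p ⟨subset_closure hp.1, hp.2⟩, hvg p hp, hdg, mul_pow,
      ← sub_eq_add_neg]
  refine ⟨M, hM0, fun x hx k hk hkm ↦ le_trans ?_ (hM x hx k hk hkm)⟩
  have hdx := hd₀ x hx
  have hux := hu₀ x hx
  have hhx0 : 0 ≤ h x := by
    rw [hh x hx]
    positivity
  have hhx : h x ≤ d x.1 := by
    rw [hh x hx, div_le_iff₀ (by positivity), ← pow_succ']
    exact pow_le_pow_left₀ hux (hud x hx) _
  rw [iteratedFDerivWithin_congr hh hx]
  exact mul_le_mul_of_nonneg_right (pow_le_pow_left₀ hhx0 hhx _) (norm_nonneg _)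
end

section
/- Let μ, s be positive integers with s ≤ μ, let 0 < c₁ < c₂ < ⋯ < c_μ be real numbers, and let γ₁, …, γ_μ ∈ ℝ satisfy Σ_{k=1}^{μ} γ_k c_k^σ = 0 for every σ = 1, …, s. Let a < b be real numbers and let η : ℝ → ℝ be continuously differentiable on [a, b] with η(x) > 0 and η′(x) ≥ 0 for all x ∈ (a, b). Let f : ℝ → ℝ be of class C^s on the interval [a, b + c_μ η(b)]. Then for every p ∈ [1, ∞] (L^p norms with respect to Lebesgue measure) one has ‖ x ↦ η(x)^{−s} Σ_{k=1}^{μ} γ_k c_k f(x + c_k η(x)) ‖_{L^p(a,b)} ≤ C · ‖ f^{(s)} ‖_{L^p(a, b + c_μ η(b))}, where C = Σ_{k=1}^{μ} |γ_k| c_k (c_k − c₁)^s and f^{(s)} is the s-th derivative of f. -/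
open Set MeasureTheory
open scoped ENNReal

/-- If a linear functional vanishes on the monomials `X, …, X ^ s`, it vanishes on
`X ^ m * (X - d) ^ j` whenever `1 ≤ m` and `m + j ≤ s`. -/
lemma sum_mul_pow_mul_sub_pow_eq_zero {ι : Type*} [Fintype ι] {s : ℕ} {c γ : ι → ℝ} (d : ℝ)
    (hvan : ∀ σ : ℕ, 1 ≤ σ → σ ≤ s → ∑ k, γ k * c k ^ σ = 0) (j : ℕ) :
    ∀ m : ℕ, 1 ≤ m → m + j ≤ s → ∑ k, γ k * c k ^ m * (c k - d) ^ j = 0 := by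
  induction j with
  | zero => intro m h1 h2; simpa using hvan m h1 h2
  | succ j ih =>
    intro m h1 h2
    have e1 := ih (m + 1) (by omega) (by omega)
    have e2 := ih m h1 (by omega)
    calc ∑ k, γ k * c k ^ m * (c k - d) ^ (j + 1)
        = ∑ k, γ k * c k ^ (m + 1) * (c k - d) ^ j
          - d * ∑ k, γ k * c k ^ m * (c k - d) ^ j := by
          rw [Finset.mul_sum, ← Finset.sum_sub_distrib]
          exact Finset.sum_congr rfl fun k _ => by ring
      _ = 0 := by rw [e1, e2]; ring

/-- Bound on the Taylor remainder by the average of the top derivative over the segment. -/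
lemma enorm_taylor_remainder_le {f : ℝ → ℝ} {n : ℕ} {y h : ℝ} (hh : 0 ≤ h)
    (hf : ∀ t ∈ Icc (0 : ℝ) 1, ContDiffAt ℝ (n + 1) f (y + t * h)) :
    ‖f (y + h) - ∑ j ∈ Finset.range (n + 1), h ^ j * ((j.factorial : ℝ)⁻¹ * iteratedDeriv j f y)‖ₑ ≤
      ENNReal.ofReal (h ^ (n + 1)) *
        ∫⁻ t in Ioc (0 : ℝ) 1, ‖iteratedDeriv (n + 1) f (y + t * h)‖ₑ := by
  have key := map_add_eq_sum_add_integral_iteratedFDeriv (f := f) (x := y) (y := h) (n := n)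
    (by simpa using hf)
  have e : f (y + h) - ∑ j ∈ Finset.range (n + 1),
      h ^ j * ((j.factorial : ℝ)⁻¹ * iteratedDeriv j f y) =
      ∫ t in Ioc (0 : ℝ) 1, (n.factorial : ℝ)⁻¹ *
        ((1 - t) ^ n * (h ^ (n + 1) * iteratedDeriv (n + 1) f (y + t * h))) := by
    rw [integral_const_mul, ← intervalIntegral.integral_of_le zero_le_one, sub_eq_iff_eq_add', key]
    simp only [smul_eq_mul, iteratedFDeriv_apply_eq_iteratedDeriv_mul_prod, Finset.prod_const,
      Finset.card_univ, Fintype.card_fin]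
    congr 1
    exact Finset.sum_congr rfl fun j _ => by ring
  rw [e, ← lintegral_const_mul' _ _ ENNReal.ofReal_ne_top]
  refine (enorm_integral_le_lintegral_enorm _).trans (setLIntegral_mono' measurableSet_Ioc ?_)
  intro t ht
  rw [← Real.enorm_of_nonneg (by positivity : 0 ≤ h ^ (n + 1)), ← enorm_mul, ← mul_assoc, enorm_mul]
  refine mul_le_of_le_one_left' ?_
  have h1 : (n.factorial : ℝ)⁻¹ ≤ 1 := inv_le_one_of_one_le₀ (mod_cast n.factorial_pos)
  have h2 : (1 - t) ^ n ≤ 1 := pow_le_one₀ (by linarith [ht.2]) (by linarith [ht.1])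
  have h3 : 0 ≤ (1 - t) ^ n := pow_nonneg (by linarith [ht.2]) _
  rw [Real.enorm_of_nonneg (by positivity), ENNReal.ofReal_le_one]
  exact mul_le_one₀ h1 h3 h2

/-- **Minkowski's integral inequality**, uniform version: an average of functions whose `L^p` norms
are at most `B` has `L^p` norm at most `B`. -/
lemma eLpNorm_lintegral_le_of_forall_le {α β : Type*} [MeasurableSpace α] [MeasurableSpace β]
    {μ : Measure α} [SFinite μ] {ν : Measure β} [IsProbabilityMeasure ν] {F : α → β → ℝ≥0∞}
    (hF : Measurable (Function.uncurry F)) {p : ℝ≥0∞} (hp : 1 ≤ p) {B : ℝ≥0∞}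
    (hB : ∀ᵐ t ∂ν, eLpNorm (fun x => F x t) p μ ≤ B) :
    eLpNorm (fun x => ∫⁻ t, F x t ∂ν) p μ ≤ B := by
  rcases eq_or_ne p ∞ with rfl | hpt
  · have h1 : ∀ᵐ t ∂ν, ∀ᵐ x ∂μ, F x t ≤ B := by
      filter_upwards [hB] with t ht
      rw [eLpNorm_exponent_top] at ht
      filter_upwards [ae_le_eLpNormEssSup (f := fun x => F x t) (μ := μ)] with x hx
      exact hx.trans ht
    have h2 : ∀ᵐ x ∂μ, ∀ᵐ t ∂ν, F x t ≤ B :=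
      (Measure.ae_ae_comm (p := fun x t => F x t ≤ B)
        (measurableSet_le hF measurable_const)).2 h1
    rw [eLpNorm_exponent_top]
    refine essSup_le_of_ae_le _ ?_
    filter_upwards [h2] with x hx
    exact (lintegral_mono_ae hx).trans (by simp)
  · have hp0 : p ≠ 0 := (zero_lt_one.trans_le hp).ne'
    have hpos : 0 < p.toReal := ENNReal.toReal_pos hp0 hpt
    have jensen : ∀ x, (∫⁻ t, F x t ∂ν) ^ p.toReal ≤ ∫⁻ t, F x t ^ p.toReal ∂ν := by
      intro x
      have h := eLpNorm_le_eLpNorm_of_exponent_le (μ := ν) (f := F x) hp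
        (hF.of_uncurry_left.aestronglyMeasurable)
      rw [eLpNorm_one_eq_lintegral_enorm, eLpNorm_eq_lintegral_rpow_enorm_toReal hp0 hpt] at h
      simp only [enorm_eq_self, one_div] at h
      exact (ENNReal.le_rpow_inv_iff hpos).1 h
    rw [eLpNorm_eq_lintegral_rpow_enorm_toReal hp0 hpt, one_div, ENNReal.rpow_inv_le_iff hpos]
    simp only [enorm_eq_self]
    calc ∫⁻ x, (∫⁻ t, F x t ∂ν) ^ p.toReal ∂μ
        ≤ ∫⁻ x, ∫⁻ t, F x t ^ p.toReal ∂ν ∂μ := lintegral_mono jensen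
      _ = ∫⁻ t, ∫⁻ x, F x t ^ p.toReal ∂μ ∂ν :=
          lintegral_lintegral_swap (hF.pow_const _).aemeasurable
      _ ≤ ∫⁻ _, B ^ p.toReal ∂ν := by
          refine lintegral_mono_ae ?_
          filter_upwards [hB] with t ht
          rw [eLpNorm_eq_lintegral_rpow_enorm_toReal hp0 hpt, one_div,
            ENNReal.rpow_inv_le_iff hpos] at ht
          simpa only [enorm_eq_self] using ht
      _ = B ^ p.toReal := by simp

/-- An injective map with derivative at least one does not increase Lebesgue measure under push
forward. -/
lemma map_restrict_le_of_one_le_deriv {φ φ' : ℝ → ℝ} {s J : Set ℝ} (hs : MeasurableSet s)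
    (hφm : Measurable φ) (hφ : ∀ x ∈ s, HasDerivWithinAt φ (φ' x) s x) (hφ' : ∀ x ∈ s, 1 ≤ φ' x)
    (hinj : InjOn φ s) (hmaps : MapsTo φ s J) :
    Measure.map φ (volume.restrict s) ≤ volume.restrict J := by
  refine Measure.le_iff.2 fun A hA => ?_
  rw [Measure.map_apply hφm hA, ← lintegral_indicator_one (hφm hA), ← lintegral_indicator_one hA]
  calc ∫⁻ x in s, (φ ⁻¹' A).indicator 1 x
      ≤ ∫⁻ x in s, ENNReal.ofReal |φ' x| * A.indicator 1 (φ x) := by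
        refine setLIntegral_mono' hs fun x hx => ?_
        have : 1 ≤ ENNReal.ofReal |φ' x| :=
          ENNReal.one_le_ofReal.2 ((hφ' x hx).trans (le_abs_self _))
        exact le_mul_of_one_le_left' this
    _ = ∫⁻ x in φ '' s, A.indicator 1 x :=
        (lintegral_image_eq_lintegral_abs_deriv_mul hs hφ hinj _).symm
    _ ≤ ∫⁻ x in J, A.indicator 1 x := lintegral_mono_set hmaps.image_subset

/-- Averaging `H` along the maps `x ↦ x + (d + t * e) * η x`, for nondecreasing `η`, does not
increase its `L^p` norm. -/
lemma eLpNorm_lintegral_comp_add_mul_le {η : ℝ → ℝ} {a b d e : ℝ} {J : Set ℝ} (hd : 0 ≤ d)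
    (he : 0 ≤ e) (hηm : Measurable η) (hηd : DifferentiableOn ℝ η (Ioo a b))
    (hηmono : MonotoneOn η (Ioo a b))
    (hmaps : ∀ t ∈ Ioc (0 : ℝ) 1, ∀ x ∈ Ioo a b, x + (d + t * e) * η x ∈ J)
    {H : ℝ → ℝ≥0∞} (hH : Measurable H) {p : ℝ≥0∞} (hp : 1 ≤ p) :
    eLpNorm (fun x => ∫⁻ t in Ioc (0 : ℝ) 1, H (x + (d + t * e) * η x)) p
      (volume.restrict (Ioo a b)) ≤ eLpNorm H p (volume.restrict J) := by
  have : IsProbabilityMeasure (volume.restrict (Ioc (0 : ℝ) 1)) := ⟨by simp⟩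
  refine eLpNorm_lintegral_le_of_forall_le
    (F := fun x t => H (x + (d + t * e) * η x)) (hH.comp (by fun_prop)) hp ?_
  filter_upwards [ae_restrict_mem measurableSet_Ioc] with t ht
  have hc : 0 ≤ d + t * e := add_nonneg hd (mul_nonneg ht.1.le he)
  have hφm : Measurable fun x => x + (d + t * e) * η x := by fun_prop
  have hle := map_restrict_le_of_one_le_deriv (J := J) measurableSet_Ioo hφm
    (φ' := fun x => 1 + (d + t * e) * derivWithin η (Ioo a b) x)
    (fun x hx => (hasDerivWithinAt_id x _).add
      ((hηd x hx).hasDerivWithinAt.const_mul (d + t * e)))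
    (fun x _ => by nlinarith [mul_nonneg hc (hηmono.derivWithin_nonneg (x := x))])
    (StrictMonoOn.injOn fun x hx y hy hxy => by
      nlinarith [mul_le_mul_of_nonneg_left (hηmono hx hy hxy.le) hc])
    (fun x hx => hmaps t ht x hx)
  calc eLpNorm (fun x => H (x + (d + t * e) * η x)) p (volume.restrict (Ioo a b))
      = eLpNorm H p (Measure.map (fun x => x + (d + t * e) * η x)
          (volume.restrict (Ioo a b))) :=
        (eLpNorm_map_measure hH.aestronglyMeasurable hφm.aemeasurable).symm
    _ ≤ _ := eLpNorm_mono_measure _ hle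

/-- A function continuous on a measurable set, extended by zero, is measurable. -/
lemma measurable_indicator_of_continuousOn {g : ℝ → ℝ} {s : Set ℝ} (hs : MeasurableSet s)
    (hg : ContinuousOn g s) : Measurable (s.indicator g) := by
  classical
  rw [← piecewise_eq_indicator]
  exact hg.measurable_piecewise continuousOn_const hs

/-- The one-dimensional key lemma (Lemma 3.4 of the paper): for coefficients `γ_k`
annihilating the powers `c_k^σ`, `σ = 1, …, s`, one has the `L^p` bound
`‖η^{-s} Σ γ_k c_k f(· + c_k η(·))‖_{L^p(a,b)} ≤ C ‖f^{(s)}‖_{L^p(a, b + c_μ η(b))}`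
with `C = Σ |γ_k| c_k (c_k − c₁)^s`. -/
theorem stmt9 (μ s : ℕ) (hs : 0 < s) (hsμ : s ≤ μ)
    (c γ : Fin μ → ℝ)
    (hcpos : 0 < c ⟨0, by omega⟩) (hcmono : StrictMono c)
    (hvan : ∀ σ : ℕ, 1 ≤ σ → σ ≤ s → ∑ k, γ k * c k ^ σ = 0)
    (a b : ℝ) (hab : a < b)
    (η : ℝ → ℝ) (hη : ContDiffOn ℝ 1 η (Icc a b))
    (hηpos : ∀ x ∈ Ioo a b, 0 < η x)
    (hη' : ∀ x ∈ Ioo a b, 0 ≤ deriv η x)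
    (f : ℝ → ℝ)
    (hf : ContDiffOn ℝ (s : ℕ∞) f (Icc a (b + c ⟨μ - 1, by omega⟩ * η b)))
    (p : ℝ≥0∞) (hp : 1 ≤ p) :
    eLpNorm (fun x => (η x ^ s)⁻¹ * ∑ k, γ k * c k * f (x + c k * η x)) p
        (volume.restrict (Ioo a b)) ≤
      ENNReal.ofReal (∑ k, |γ k| * c k * (c k - c ⟨0, by omega⟩) ^ s) *
        eLpNorm (iteratedDeriv s f) p
          (volume.restrict (Ioo a (b + c ⟨μ - 1, by omega⟩ * η b))) := by
  obtain ⟨n, rfl⟩ : ∃ n, s = n + 1 := ⟨s - 1, by omega⟩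
  set c₀ := c ⟨0, by omega⟩ with hc₀
  set J := Ioo a (b + c ⟨μ - 1, by omega⟩ * η b) with hJ
  have hc₀le : ∀ k, c₀ ≤ c k := fun k => hcmono.monotone (Fin.mk_le_of_le_val (Nat.zero_le _))
  have hlec : ∀ k, c k ≤ c ⟨μ - 1, by omega⟩ := fun k =>
    hcmono.monotone (Fin.le_def.2 (by have := k.2; simp only; omega))
  have hηd : DifferentiableOn ℝ η (Ioo a b) :=
    (hη.differentiableOn (by simp)).mono Ioo_subset_Icc_self
  have hηmono : MonotoneOn η (Icc a b) :=
    monotoneOn_of_deriv_nonneg (convex_Icc a b) hη.continuousOn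
      (by rwa [interior_Icc]) (by rwa [interior_Icc])
  have hmem : ∀ x ∈ Ioo a b, ∀ k, ∀ t ∈ Icc (0 : ℝ) 1, x + (c₀ + t * (c k - c₀)) * η x ∈ J := by
    intro x hx k t ht
    have h1 : 0 < η x := hηpos x hx
    have h2 : η x ≤ η b := hηmono ⟨hx.1.le, hx.2.le⟩ ⟨hab.le, le_rfl⟩ hx.2.le
    have h3 : 0 ≤ t * (c k - c₀) := mul_nonneg ht.1 (sub_nonneg.2 (hc₀le k))
    have h4 : c₀ + t * (c k - c₀) ≤ c ⟨μ - 1, by omega⟩ := by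
      nlinarith [ht.2, hc₀le k, hlec k]
    have h5 : 0 < (c₀ + t * (c k - c₀)) * η x := by positivity
    have h6 : (c₀ + t * (c k - c₀)) * η x ≤ c ⟨μ - 1, by omega⟩ * η b :=
      mul_le_mul h4 h2 h1.le (hcpos.le.trans (hlec _))
    exact ⟨by linarith [hx.1], by linarith [hx.2]⟩
  have hfJ : ContDiffOn ℝ (n + 1) f J := by
    simpa using hf.mono Ioo_subset_Icc_self
  have hfat : ∀ u ∈ J, ContDiffAt ℝ (n + 1) f u := fun u hu =>
    hfJ.contDiffAt (isOpen_Ioo.mem_nhds hu)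
  have hgc : ContinuousOn (iteratedDeriv (n + 1) f) J :=
    (hfJ.continuousOn_iteratedDerivWithin (m := n + 1) (by simp) isOpen_Ioo.uniqueDiffOn).congr
      fun u hu => (iteratedDerivWithin_of_isOpen isOpen_Ioo hu).symm
  set H : ℝ → ℝ≥0∞ := fun u => ‖J.indicator (iteratedDeriv (n + 1) f) u‖ₑ with hH
  have hHm : Measurable H :=
    (measurable_indicator_of_continuousOn measurableSet_Ioo hgc).enorm
  have hHB : eLpNorm H p (volume.restrict J) =
      eLpNorm (iteratedDeriv (n + 1) f) p (volume.restrict J) := by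
    refine eLpNorm_congr_enorm_ae ?_
    filter_upwards [ae_restrict_mem measurableSet_Ioo] with u hu
    simp [hH, indicator_of_mem hu]
  set ζ : ℝ → ℝ := (Ioo a b).indicator η with hζ
  have hζη : EqOn ζ η (Ioo a b) := fun x hx => indicator_of_mem hx η
  have hζm : Measurable ζ :=
    measurable_indicator_of_continuousOn measurableSet_Ioo hηd.continuousOn
  set I : Fin μ → ℝ → ℝ≥0∞ := fun k x =>
    ∫⁻ t in Ioc (0 : ℝ) 1, H (x + (c₀ + t * (c k - c₀)) * ζ x) with hI
  have hIm : ∀ k, Measurable (I k) := fun k =>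
    Measurable.lintegral_prod_right (hHm.comp (by fun_prop))
  have hIle : ∀ k, eLpNorm (I k) p (volume.restrict (Ioo a b)) ≤
      eLpNorm (iteratedDeriv (n + 1) f) p (volume.restrict J) := by
    intro k
    rw [← hHB]
    refine eLpNorm_lintegral_comp_add_mul_le hcpos.le (sub_nonneg.2 (hc₀le k)) hζm
      (hηd.congr hζη) ((hηmono.mono Ioo_subset_Icc_self).congr hζη.symm) ?_ hHm hp
    intro t ht x hx
    rw [hζη hx]
    exact hmem x hx k t ⟨ht.1.le, ht.2⟩
  have hw : ∀ k, 0 ≤ |γ k| * c k * (c k - c₀) ^ (n + 1) := fun k =>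
    mul_nonneg (mul_nonneg (abs_nonneg _) (hcpos.le.trans (hc₀le k)))
      (pow_nonneg (sub_nonneg.2 (hc₀le k)) _)
  have hpt : ∀ x ∈ Ioo a b, ‖(η x ^ (n + 1))⁻¹ * ∑ k, γ k * c k * f (x + c k * η x)‖ₑ ≤
      ∑ k, ENNReal.ofReal (|γ k| * c k * (c k - c₀) ^ (n + 1)) * I k x := by
    intro x hx
    have hηx : 0 < η x := hηpos x hx
    set A : ℕ → ℝ := fun j => (j.factorial : ℝ)⁻¹ * iteratedDeriv j f (x + c₀ * η x) with hA
    set R : Fin μ → ℝ := fun k => f (x + c k * η x) -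
      ∑ j ∈ Finset.range (n + 1), ((c k - c₀) * η x) ^ j * A j with hR
    have hpoly : ∑ k, γ k * c k *
        ∑ j ∈ Finset.range (n + 1), ((c k - c₀) * η x) ^ j * A j = 0 := by
      simp_rw [Finset.mul_sum]
      rw [Finset.sum_comm]
      refine Finset.sum_eq_zero fun j hj => ?_
      have h := sum_mul_pow_mul_sub_pow_eq_zero c₀ hvan j 1 le_rfl
        (by have := Finset.mem_range.1 hj; omega)
      calc _ = (∑ k, γ k * c k ^ 1 * (c k - c₀) ^ j) * (η x ^ j * A j) := by
            rw [Finset.sum_mul]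
            exact Finset.sum_congr rfl fun k _ => by rw [mul_pow]; ring
        _ = 0 := by rw [h, zero_mul]
    have hsum : (η x ^ (n + 1))⁻¹ * ∑ k, γ k * c k * f (x + c k * η x) =
        ∑ k, (η x ^ (n + 1))⁻¹ * (γ k * c k) * R k := by
      rw [← sub_zero (∑ k, γ k * c k * f (x + c k * η x)), ← hpoly, ← Finset.sum_sub_distrib,
        Finset.mul_sum]
      exact Finset.sum_congr rfl fun k _ => by simp only [hR]; ring
    rw [hsum]
    refine (enorm_sum_le _ _).trans (Finset.sum_le_sum fun k _ => ?_)
    have hck : 0 ≤ c k := hcpos.le.trans (hc₀le k)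
    have hh : 0 ≤ (c k - c₀) * η x := mul_nonneg (sub_nonneg.2 (hc₀le k)) hηx.le
    have hpath : ∀ t : ℝ, x + c₀ * η x + t * ((c k - c₀) * η x) =
        x + (c₀ + t * (c k - c₀)) * η x := fun t => by ring
    have hrem := enorm_taylor_remainder_le (f := f) (n := n) (y := x + c₀ * η x) hh
      fun t ht => by rw [hpath]; exact hfat _ (hmem x hx k t ht)
    rw [show x + c₀ * η x + (c k - c₀) * η x = x + c k * η x by ring] at hrem
    have hIx : ∫⁻ t in Ioc (0 : ℝ) 1,
        ‖iteratedDeriv (n + 1) f (x + c₀ * η x + t * ((c k - c₀) * η x))‖ₑ = I k x := by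
      refine setLIntegral_congr_fun measurableSet_Ioc fun t ht => ?_
      simp only [hH]
      rw [hζη hx, hpath, indicator_of_mem (hmem x hx k t ⟨ht.1.le, ht.2⟩)]
    rw [hIx] at hrem
    have hcoef : ‖(η x ^ (n + 1))⁻¹ * (γ k * c k)‖ₑ * ENNReal.ofReal (((c k - c₀) * η x) ^ (n + 1))
        = ENNReal.ofReal (|γ k| * c k * (c k - c₀) ^ (n + 1)) := by
      rw [← ofReal_norm, ← ENNReal.ofReal_mul (norm_nonneg _)]
      congr 1
      rw [norm_mul, norm_mul, Real.norm_of_nonneg (by positivity), Real.norm_of_nonneg hck,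
        Real.norm_eq_abs, mul_pow]
      field_simp
    rw [enorm_mul, ← hcoef, mul_assoc]
    exact mul_le_mul_right hrem _
  calc eLpNorm (fun x => (η x ^ (n + 1))⁻¹ * ∑ k, γ k * c k * f (x + c k * η x)) p
        (volume.restrict (Ioo a b))
      ≤ eLpNorm (∑ k, fun x => ENNReal.ofReal (|γ k| * c k * (c k - c₀) ^ (n + 1)) * I k x) p
          (volume.restrict (Ioo a b)) := by
        refine eLpNorm_mono_enorm_ae ?_
        filter_upwards [ae_restrict_mem measurableSet_Ioo] with x hx
        simpa only [enorm_eq_self, Finset.sum_apply] using hpt x hx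
    _ ≤ ∑ k, eLpNorm (fun x => ENNReal.ofReal (|γ k| * c k * (c k - c₀) ^ (n + 1)) * I k x) p
          (volume.restrict (Ioo a b)) :=
        eLpNorm_sum_le (fun k _ => ((hIm k).const_mul _).aestronglyMeasurable) hp
    _ ≤ ∑ k, ENNReal.ofReal (|γ k| * c k * (c k - c₀) ^ (n + 1)) *
          eLpNorm (iteratedDeriv (n + 1) f) p (volume.restrict J) := by
        refine Finset.sum_le_sum fun k _ => ?_
        refine (eLpNorm_le_nnreal_smul_eLpNorm_of_ae_le_mul' (g := I k)
          (c := (|γ k| * c k * (c k - c₀) ^ (n + 1)).toNNReal)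
          (Filter.Eventually.of_forall fun x => le_rfl) p).trans ?_
        exact mul_le_mul_right (hIle k) _
    _ = ENNReal.ofReal (∑ k, |γ k| * c k * (c k - c₀) ^ (n + 1)) *
          eLpNorm (iteratedDeriv (n + 1) f) p (volume.restrict J) := by
        rw [← Finset.sum_mul, ENNReal.ofReal_sum_of_nonneg fun k _ => hw k]
end

section
/- Let N be a positive integer, U an open subset of ℝ^N, O an arbitrary subset of ℝ^N, k a natural number, and φ₁, φ₂ : ℝ^N → ℝ functions that are of class C^k on U (ContDiffOn of order k) and such that for every x ∈ U ∩ (frontier of O) and every j ≤ k the j-th iterated Fréchet derivatives (taken within U) of φ₁ and φ₂ at x coincide. Define ψ : ℝ^N → ℝ by ψ(x) = φ₁(x) if x ∈ closure(O) and ψ(x) = φ₂(x) otherwise. Then ψ is of class C^k on U. -/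
open Set

open Classical in
/-- Two functions with the same value and the same derivative at frontier points of `C` glue along
`C` to a differentiable function. -/
theorem HasFDerivWithinAt.piecewise_of_frontier {𝕜 E F : Type*} [NontriviallyNormedField 𝕜]
    [NormedAddCommGroup E] [NormedSpace 𝕜 E] [NormedAddCommGroup F] [NormedSpace 𝕜 F]
    {f g : E → F} {f' g' : E →L[𝕜] F} {s C : Set E} {x : E}
    (hf : HasFDerivWithinAt f f' s x) (hg : HasFDerivWithinAt g g' s x)
    (hfg : x ∈ frontier C → f x = g x) (hfg' : x ∈ frontier C → f' = g') :
    HasFDerivWithinAt (C.piecewise f g) (if x ∈ C then f' else g') s x := by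
  rw [← inter_union_compl s C]
  refine HasFDerivWithinAt.union ?_ ?_
  · by_cases hx : x ∈ closure C
    · have key : f x = C.piecewise f g x ∧ f' = if x ∈ C then f' else g' := by
        by_cases hxC : x ∈ C
        · simp [hxC]
        · have hfr : x ∈ frontier C := ⟨hx, fun h => hxC (interior_subset h)⟩
          simp [hxC, hfg hfr, hfg' hfr]
      rw [← key.2]
      exact (hf.mono inter_subset_left).congr
        (fun y hy => piecewise_eq_of_mem _ _ _ hy.2) key.1.symm
    · exact .of_notMem_closure fun h => hx (closure_mono inter_subset_right h)
  · by_cases hx : x ∈ closure Cᶜ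
    · have key : g x = C.piecewise f g x ∧ g' = if x ∈ C then f' else g' := by
        by_cases hxC : x ∈ C
        · have hfr : x ∈ frontier C := by
            rw [frontier_eq_closure_inter_closure]
            exact ⟨subset_closure hxC, hx⟩
          simp [hxC, hfg hfr, hfg' hfr]
        · simp [hxC]
      rw [← key.2]
      exact (hg.mono inter_subset_left).congr
        (fun y hy => piecewise_eq_of_notMem _ _ _ hy.2) key.1.symm
    · exact .of_notMem_closure fun h => hx (closure_mono inter_subset_right h)

open Classical in
/-- Taylor series which agree at frontier points of `C` glue along `C` to a Taylor series. -/
theorem HasFTaylorSeriesUpToOn.piecewise_of_frontier {𝕜 E F : Type*} [NontriviallyNormedField 𝕜]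
    [NormedAddCommGroup E] [NormedSpace 𝕜 E] [NormedAddCommGroup F] [NormedSpace 𝕜 F]
    {n : WithTop ℕ∞} {f g : E → F} {p q : E → FormalMultilinearSeries 𝕜 E F} {s C : Set E}
    (hf : HasFTaylorSeriesUpToOn n f p s) (hg : HasFTaylorSeriesUpToOn n g q s)
    (hpq : ∀ x ∈ s ∩ frontier C, ∀ m : ℕ, m ≤ n → p x m = q x m) :
    HasFTaylorSeriesUpToOn n (C.piecewise f g) (C.piecewise p q) s := by
  have hcoeff (m : ℕ) : (C.piecewise p q · m) = C.piecewise (p · m) (q · m) := by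
    ext1 x
    by_cases hx : x ∈ C <;> simp [hx]
  refine ⟨fun x hx => ?_, fun m hm x hx => ?_, fun m hm => ?_⟩
  · by_cases hxC : x ∈ C
    · simpa [hxC] using hf.zero_eq x hx
    · simpa [hxC] using hg.zero_eq x hx
  · rw [hcoeff]
    have hm' : ((m.succ : ℕ) : WithTop ℕ∞) ≤ n := by
      exact ENat.add_one_natCast_le_withTop_of_lt hm
    have hderiv : (C.piecewise p q x m.succ).curryLeft =
        if x ∈ C then (p x m.succ).curryLeft else (q x m.succ).curryLeft := by
      split_ifs with hxC <;> simp only [hxC, not_false_eq_true, piecewise_eq_of_mem,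
        piecewise_eq_of_notMem]
    rw [hderiv]
    exact (hf.fderivWithin m hm x hx).piecewise_of_frontier (hg.fderivWithin m hm x hx)
      (fun h => hpq x ⟨hx, h⟩ m hm.le)
      (fun h => congrArg _ (hpq x ⟨hx, h⟩ m.succ hm'))
  · rw [hcoeff]
    exact ContinuousOn.piecewise (fun x hx => hpq x hx m hm)
      ((hf.cont m hm).mono inter_subset_left) ((hg.cont m hm).mono inter_subset_left)

/-- Gluing lemma: if `φ₁, φ₂` are `C^k` on an open set `U` and all their iterated
derivatives within `U` up to order `k` agree on `U ∩ ∂O`, then the function equal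
to `φ₁` on `closure O` and to `φ₂` elsewhere is `C^k` on `U`. -/
theorem stmt12 (N : ℕ) (hN : 0 < N)
    (U : Set (EuclideanSpace ℝ (Fin N))) (hU : IsOpen U)
    (O : Set (EuclideanSpace ℝ (Fin N)))
    (k : ℕ)
    (φ₁ φ₂ : EuclideanSpace ℝ (Fin N) → ℝ)
    (hφ₁ : ContDiffOn ℝ (k : ℕ∞) φ₁ U) (hφ₂ : ContDiffOn ℝ (k : ℕ∞) φ₂ U)
    (hagree : ∀ x ∈ U ∩ frontier O, ∀ j : ℕ, j ≤ k →
      iteratedFDerivWithin ℝ j φ₁ U x = iteratedFDerivWithin ℝ j φ₂ U x)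
    (ψ : EuclideanSpace ℝ (Fin N) → ℝ)
    (hψ₁ : ∀ x ∈ closure O, ψ x = φ₁ x)
    (hψ₂ : ∀ x ∉ closure O, ψ x = φ₂ x) :
    ContDiffOn ℝ (k : ℕ∞) ψ U := by
  classical
  have hT := (hφ₁.ftaylorSeriesWithin hU.uniqueDiffOn).piecewise_of_frontier (C := closure O)
    (hφ₂.ftaylorSeriesWithin hU.uniqueDiffOn) fun x hx m hm =>
      hagree x ⟨hx.1, frontier_closure_subset hx.2⟩ m (by exact_mod_cast hm)
  refine HasFTaylorSeriesUpToOn.contDiffOn (hT.congr fun x _ => ?_)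
  by_cases hx : x ∈ closure O
  · simp [hx, hψ₁ x hx]
  · simp [hx, hψ₂ x hx]
end

section
/- Let π/2 < β < π and 0 < ε < 1, and set A = cos(β/2). With Ω, Ω(ε) the circular sectors defined in the context and Ω̃(ε) = {(x₁, x₂) ∈ ℝ² : g(x₂) < x₁ and x₁² + x₂² < 1}, where g(x₂) = ε − |x₂|·tan(β/2) if |x₂| ≤ ε·sin β and g(x₂) = |x₂|·cot β if |x₂| > ε·sin β, one has the inclusions Ω(ε) ⊆ Ω̃(ε) ⊆ Ω(Aε) ⊆ Ω. -/
open Set Real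

/-- The inclusions `Ω(ε) ⊆ Ω̃(ε) ⊆ Ω(Aε) ⊆ Ω` with `A = cos(β/2)` for the Lipschitz
modification `Ω̃(ε)` of the truncated circular sector `Ω(ε)`. -/
theorem stmt13 (β ε : ℝ) (hβ₁ : Real.pi / 2 < β) (hβ₂ : β < Real.pi)
    (hε₁ : 0 < ε) (hε₂ : ε < 1)
    (Ω : Set (ℝ × ℝ))
    (hΩ : Ω = {p | ∃ r θ : ℝ, 0 < r ∧ r < 1 ∧ -β < θ ∧ θ < β ∧
      p = (r * Real.cos θ, r * Real.sin θ)})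
    (Ωe : ℝ → Set (ℝ × ℝ))
    (hΩe : ∀ e, Ωe e = {p | ∃ r θ : ℝ, e < r ∧ r < 1 ∧ -β < θ ∧ θ < β ∧
      p = (r * Real.cos θ, r * Real.sin θ)})
    (g : ℝ → ℝ)
    (hg₁ : ∀ x : ℝ, |x| ≤ ε * Real.sin β → g x = ε - |x| * Real.tan (β / 2))
    (hg₂ : ∀ x : ℝ, ε * Real.sin β < |x| → g x = |x| * Real.cot β)
    (Ωt : Set (ℝ × ℝ))
    (hΩt : Ωt = {p | g p.2 < p.1 ∧ p.1 ^ 2 + p.2 ^ 2 < 1}) :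
    Ωe ε ⊆ Ωt ∧ Ωt ⊆ Ωe (Real.cos (β / 2) * ε) ∧ Ωe (Real.cos (β / 2) * ε) ⊆ Ω := by
  have hA : 0 < cos (β / 2) := cos_pos_of_mem_Ioo ⟨by linarith, by linarith⟩
  have hS : 0 < sin β := sin_pos_of_pos_of_lt_pi (by linarith [pi_pos]) hβ₂
  have hdouble : sin β = 2 * sin (β / 2) * cos (β / 2) := by
    rw [← sin_two_mul]; ring_nf
  have hcosβ : cos β = 2 * cos (β / 2) ^ 2 - 1 := by
    rw [← cos_two_mul]; ring_nf
  have hpyth := sin_sq_add_cos_sq (β / 2)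
  have hcos_neg : cos β < 0 := cos_neg_of_pi_div_two_lt_of_lt hβ₁ (by linarith)
  have hs : 0 < sin (β / 2) := sin_pos_of_pos_of_lt_pi (by linarith [pi_pos]) (by linarith)
  have hg_chord : ∀ x t,
      ε - t * tan (β / 2) < x ↔ ε * cos (β / 2) < x * cos (β / 2) + t * sin (β / 2) := by
    intro x t
    rw [tan_eq_sin_div_cos, ← mul_lt_mul_iff_left₀ hA]
    have : (ε - t * (sin (β / 2) / cos (β / 2))) * cos (β / 2)
        = ε * cos (β / 2) - t * sin (β / 2) := by field_simp
    rw [this, sub_lt_iff_lt_add]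
  have hg_ray : ∀ x t, t * cot β < x ↔ t * cos β < x * sin β := by
    intro x t
    rw [cot_eq_cos_div_sin, ← mul_div_assoc, div_lt_iff₀ hS]
  have hnorm : ∀ r θ : ℝ, (r * cos θ) ^ 2 + (r * sin θ) ^ 2 = r ^ 2 := by
    intro r θ
    linear_combination r ^ 2 * sin_sq_add_cos_sq θ
  refine ⟨?_, ?_, ?_⟩
  · rw [hΩe, hΩt]
    rintro _ ⟨r, θ, hr, hr1, hθ₁, hθ₂, rfl⟩
    have hr0 : 0 < r := hε₁.trans hr
    have hθ : |θ| < β := abs_lt.2 ⟨hθ₁, hθ₂⟩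
    have ht : |r * sin θ| = r * sin |θ| := by
      rw [abs_mul, abs_of_pos hr0, abs_sin_eq_sin_abs_of_abs_le_pi (by linarith)]
    refine ⟨?_, ?_⟩
    · show g (r * sin θ) < r * cos θ
      rcases le_or_gt |r * sin θ| (ε * sin β) with h | h
      · rw [hg₁ _ h, hg_chord, ht, ← cos_abs θ]
        have hcos : cos (β / 2) ≤ cos (|θ| - β / 2) := by
          rw [← cos_abs (|θ| - β / 2)]
          exact cos_le_cos_of_nonneg_of_le_pi (abs_nonneg _) (by linarith)
            (abs_le.2 ⟨by linarith [abs_nonneg θ], by linarith⟩)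
        rw [cos_sub] at hcos
        nlinarith
      · rw [hg₂ _ h, hg_ray, ht, ← cos_abs θ]
        have hsin : 0 < sin (β - |θ|) :=
          sin_pos_of_pos_of_lt_pi (by linarith) (by linarith [abs_nonneg θ])
        rw [sin_sub] at hsin
        nlinarith
    · show (r * cos θ) ^ 2 + (r * sin θ) ^ 2 < 1
      rw [hnorm]
      nlinarith
  · rw [hΩe, hΩt]
    rintro ⟨x, y⟩ ⟨hgx, hxy⟩
    change g y < x at hgx
    change x ^ 2 + y ^ 2 < 1 at hxy
    obtain ⟨r, θ, hr0, hθ, rfl, rfl⟩ : ∃ r θ : ℝ, 0 ≤ r ∧ |θ| ≤ π ∧ x = r * cos θ ∧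
        y = r * sin θ :=
      ⟨‖(⟨x, y⟩ : ℂ)‖, Complex.arg ⟨x, y⟩, norm_nonneg _, Complex.abs_arg_le_pi _,
        (Complex.norm_mul_cos_arg ⟨x, y⟩).symm, (Complex.norm_mul_sin_arg ⟨x, y⟩).symm⟩
    have ht : |r * sin θ| = r * sin |θ| := by
      rw [abs_mul, abs_of_nonneg hr0, abs_sin_eq_sin_abs_of_abs_le_pi hθ]
    have hr1 : r < 1 := by
      rw [hnorm] at hxy
      nlinarith
    suffices h : cos (β / 2) * ε < r ∧ r * sin |θ| * cos β < r * cos θ * sin β by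
      refine ⟨r, θ, h.1, hr1, ?_⟩
      have hlt : |θ| < β := by
        by_contra! hle
        have hsin : 0 ≤ sin (|θ| - β) :=
          sin_nonneg_of_nonneg_of_le_pi (by linarith) (by linarith [pi_pos])
        rw [sin_sub, cos_abs] at hsin
        nlinarith [h.2]
      exact ⟨(abs_lt.1 hlt).1, (abs_lt.1 hlt).2, rfl⟩
    rcases le_or_gt |r * sin θ| (ε * sin β) with h | h
    · rw [hg₁ _ h, hg_chord, ht] at hgx
      rw [ht] at h
      refine ⟨?_, ?_⟩
      · have hcos := cos_le_one (|θ| - β / 2)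
        rw [cos_sub, cos_abs] at hcos
        nlinarith
      · have hsplit : cos (β / 2) = cos β * cos (β / 2) + sin β * sin (β / 2) := by
          rw [← cos_sub]; ring_nf
        have h₁ := mul_lt_mul_of_pos_right hgx hS
        have h₂ := mul_le_mul_of_nonneg_right h hA.le
        refine lt_of_mul_lt_mul_right ?_ hA.le
        linear_combination h₁ + h₂ - r * sin |θ| * hsplit
    · rw [hg₂ _ h, hg_ray, ht] at hgx
      rw [ht] at h
      refine ⟨?_, hgx⟩
      have hsin_half : 1 / 2 < sin (β / 2) := by nlinarith
      have hle : r * sin |θ| ≤ r := mul_le_of_le_one_right hr0 (sin_le_one _)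
      have : cos (β / 2) < sin β := by rw [hdouble]; nlinarith
      nlinarith
  · rw [hΩe, hΩ]
    rintro p ⟨r, θ, hr, h⟩
    exact ⟨r, θ, (mul_pos hA hε₁).trans hr, h⟩
end

section
/- Let ν > 0, λ* ∈ ℝ, and let f : ℝ → ℝ be continuously differentiable with f(λ*) = 0 and f′(λ*) ≠ 0. Then there exist ε > 0, r > 0 and a function φ : ℝ → ℝ with φ(0) = λ* such that: (a) for every δ ∈ [0, ε), φ(δ) is the unique λ with |λ − λ*| < r satisfying f(λ) − δ·f(δ^{1/ν}·λ) = 0; and (b) φ(δ) = λ* + (f(0)/f′(λ*))·δ + o(δ) as δ → 0⁺, i.e. (φ(δ) − λ* − (f(0)/f′(λ*))·δ)/δ tends to 0 as δ tends to 0 from the right. -/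
open Set Filter
open scoped Topology

/-- Implicit function theorem for a simple zero of a real `C¹` function `f`, perturbed by a term
depending on two small parameters: the zero is locally unique and depends continuously on them. -/
theorem exists_perturbed_simple_zero {f : ℝ → ℝ} {a : ℝ} (hf : ContDiff ℝ 1 f)
    (hf0 : f a = 0) (hf' : deriv f a ≠ 0) :
    ∃ ψ : ℝ × ℝ → ℝ, Tendsto ψ (𝓝 0) (𝓝 a) ∧
      ∀ᶠ p in 𝓝 (0 : ℝ × ℝ) ×ˢ 𝓝 a, f p.2 - p.1.1 * f (p.1.2 * p.2) = 0 ↔ ψ p.1 = p.2 := by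
  set F : (ℝ × ℝ) × ℝ → ℝ := fun p => f p.2 - p.1.1 * f (p.1.2 * p.2) with hF
  set u : (ℝ × ℝ) × ℝ := (0, a) with hu
  have hFu : F u = 0 := by simp [hF, hu, hf0]
  have hFs : HasStrictFDerivAt F (fderiv ℝ F u) u :=
    ContDiff.hasStrictFDerivAt (n := 1) (by fun_prop) one_ne_zero
  have hpart : HasDerivAt f ((fderiv ℝ F u ∘L .inr ℝ (ℝ × ℝ) ℝ) 1) a := by
    have h : HasFDerivAt (F ∘ fun x => ((0 : ℝ × ℝ), x)) (fderiv ℝ F u ∘L .inr ℝ (ℝ × ℝ) ℝ) a :=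
      hFs.hasFDerivAt.comp a (hasFDerivAt_prodMk_right _ _)
    convert! h.hasDerivAt using 1
    ext x
    simp [hF]
  have hinv : (fderiv ℝ F u ∘L .inr ℝ (ℝ × ℝ) ℝ).IsInvertible := by
    refine ⟨ContinuousLinearEquiv.unitsEquivAut ℝ (Units.mk0 _ hf'), ?_⟩
    ext
    simp [hpart.deriv]
  refine ⟨hFs.implicitFunctionOfProdDomain hinv, hFs.tendsto_implicitFunctionOfProdDomain hinv, ?_⟩
  rw [← nhds_prod_eq]
  simpa only [hFu] using hFs.eventually_apply_eq_iff_implicitFunctionOfProdDomain hinv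

/-- Implicit-function lemma of Section 5: near a simple zero `λ*` of `f`, for small
`δ ≥ 0` the equation `f(λ) − δ·f(δ^{1/ν}·λ) = 0` has a unique solution `φ(δ)` near
`λ*`, and `φ(δ) = λ* + (f(0)/f′(λ*))·δ + o(δ)` as `δ → 0⁺`. -/
theorem stmt15 (ν lamStar : ℝ) (hν : 0 < ν)
    (f : ℝ → ℝ) (hf : ContDiff ℝ 1 f)
    (hf0 : f lamStar = 0) (hf' : deriv f lamStar ≠ 0) :
    ∃ ε > (0 : ℝ), ∃ r > (0 : ℝ), ∃ φ : ℝ → ℝ,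
      φ 0 = lamStar ∧
      (∀ δ : ℝ, 0 ≤ δ → δ < ε →
        |φ δ - lamStar| < r ∧
        f (φ δ) - δ * f (δ ^ (1 / ν) * φ δ) = 0 ∧
        ∀ lam : ℝ, |lam - lamStar| < r →
          f lam - δ * f (δ ^ (1 / ν) * lam) = 0 → lam = φ δ) ∧
      Tendsto (fun δ => (φ δ - lamStar - (f 0 / deriv f lamStar) * δ) / δ)
        (nhdsWithin 0 (Ioi 0)) (nhds 0) := by
  obtain ⟨ψ, hψ, hiff⟩ := exists_perturbed_simple_zero hf hf0 hf'
  have hpow : Tendsto (fun δ : ℝ => δ ^ (1 / ν)) (𝓝 0) (𝓝 0) := by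
    have h := (Real.continuous_rpow_const (one_div_pos.2 hν).le).tendsto 0
    rwa [Real.zero_rpow (one_div_pos.2 hν).ne'] at h
  have hparam : Tendsto (fun δ : ℝ => (δ, δ ^ (1 / ν))) (𝓝 0) (𝓝 (0 : ℝ × ℝ)) :=
    tendsto_id.prodMk_nhds hpow
  set φ : ℝ → ℝ := fun δ => ψ (δ, δ ^ (1 / ν))
  have hφ : Tendsto φ (𝓝 0) (𝓝 lamStar) := hψ.comp hparam
  have hev : ∀ᶠ q in 𝓝 (0 : ℝ) ×ˢ 𝓝 lamStar,
      f q.2 - q.1 * f (q.1 ^ (1 / ν) * q.2) = 0 ↔ φ q.1 = q.2 :=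
    (hparam.prodMap tendsto_id).eventually hiff
  obtain ⟨ε₁, hε₁, r, hr, hball⟩ :
      ∃ ε₁ > 0, ∃ r > 0, ∀ δ lam : ℝ, |δ| < ε₁ → |lam - lamStar| < r →
        (f lam - δ * f (δ ^ (1 / ν) * lam) = 0 ↔ φ δ = lam) := by
    obtain ⟨s, hs, t, ht, hst⟩ := eventually_prod_iff.1 hev
    obtain ⟨ε₁, hε₁, hs⟩ := Metric.eventually_nhds_iff.1 hs
    obtain ⟨r, hr, ht⟩ := Metric.eventually_nhds_iff.1 ht
    exact ⟨ε₁, hε₁, r, hr, fun δ lam hδ hlam =>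
      hst (hs (by simpa [Real.dist_eq] using hδ)) (ht (by simpa [Real.dist_eq] using hlam))⟩
  obtain ⟨ε₂, hε₂, hnear⟩ := Metric.eventually_nhds_iff.1 (hφ.eventually (Metric.ball_mem_nhds _ hr))
  have hsol : ∀ δ : ℝ, 0 ≤ δ → δ < min ε₁ ε₂ →
      |φ δ - lamStar| < r ∧ f (φ δ) - δ * f (δ ^ (1 / ν) * φ δ) = 0 ∧
      ∀ lam : ℝ, |lam - lamStar| < r → f lam - δ * f (δ ^ (1 / ν) * lam) = 0 → lam = φ δ := by
    intro δ h0 hδ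
    have h₁ : |δ| < ε₁ := by rw [abs_of_nonneg h0]; exact hδ.trans_le (min_le_left _ _)
    have h₂ : |φ δ - lamStar| < r :=
      hnear (by simpa [Real.dist_eq, abs_of_nonneg h0] using hδ.trans_le (min_le_right _ _))
    exact ⟨h₂, (hball δ _ h₁ h₂).2 rfl, fun lam hlam h => ((hball δ lam h₁ hlam).1 h).symm⟩
  refine ⟨min ε₁ ε₂, lt_min hε₁ hε₂, r, hr, φ, ?_, hsol, ?_⟩
  · exact (hball 0 lamStar (by simpa using hε₁) (by simpa using hr)).1 (by simp [hf0])
  have hslope : Tendsto (fun δ => dslope f lamStar (φ δ)) (𝓝[>] 0) (𝓝 (deriv f lamStar)) := by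
    have h := (continuousAt_dslope_same.2 (hf.differentiable one_ne_zero lamStar)).tendsto
    rw [dslope_same] at h
    exact h.comp (hφ.mono_left nhdsWithin_le_nhds)
  have hnum : Tendsto (fun δ => f (δ ^ (1 / ν) * φ δ)) (𝓝[>] 0) (𝓝 (f 0)) := by
    have h := hpow.mul hφ
    rw [zero_mul] at h
    exact ((hf.continuous.tendsto 0).comp h).mono_left nhdsWithin_le_nhds
  have hlim := (hnum.div hslope hf').sub_const (f 0 / deriv f lamStar)
  rw [sub_self] at hlim
  refine hlim.congr' ?_
  filter_upwards [hslope.eventually_ne hf', self_mem_nhdsWithin,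
    mem_nhdsWithin_of_mem_nhds (Iio_mem_nhds (lt_min hε₁ hε₂))] with δ hne (hpos : 0 < δ) hlt
  have heq : (φ δ - lamStar) * dslope f lamStar (φ δ) = δ * f (δ ^ (1 / ν) * φ δ) := by
    rw [← smul_eq_mul, sub_smul_dslope, hf0, sub_zero]
    exact sub_eq_zero.1 (hsol δ hpos.le hlt).2.1
  have hquot : f (δ ^ (1 / ν) * φ δ) / dslope f lamStar (φ δ) = (φ δ - lamStar) / δ := by
    rw [div_eq_div_iff hne hpos.ne', heq, mul_comm]
  rw [Pi.div_apply, hquot, sub_div (φ δ - lamStar) (_ * δ), mul_div_cancel_right₀ _ hpos.ne']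
end
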